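/- Let 0 < q, r < ∞ and 1 < p < ∞ with r < p ≤ q, let u, w be weights on (0,∞), and let v be a weight on (0,∞) such that ∫_x^∞ v(t)^{1-p'} dt < ∞ for every x ∈ (0,∞). Then there exists a constant C > 0 such that (∫₀^∞ (∫_x^∞ (∫_t^∞ h(s) ds)^r u(t) dt)^{q/r} w(x) dx)^{1/q} ≤ C (∫₀^∞ h(t)^p v(t) dt)^{1/p} for all h ∈ M⁺(0,∞) if and only if E₁ < ∞ and E₄ < ∞, where E₁ := sup_{t∈(0,∞)} (∫₀^t w(s) (∫_s^t u)^{q/r} ds)^{1/q} (∫_t^∞ v^{1-p'})^{1/p'} and E₄ := sup_{t∈(0,∞)} (∫₀^t w)^{1/q} (∫_t^∞ (∫_t^x u)^{r/(p-r)} u(x) (∫_x^∞ v^{1-p'})^{(p-1)r/(p-r)} dx)^{(p-r)/(pr)}. -/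

import Mathlib

open MeasureTheory Set ENNReal NNReal

noncomputable section

/-- Lebesgue measure restricted to `(0, ∞)`. -/
def mu0 : Measure ℝ := volume.restrict (Ioi (0 : ℝ))

/-- A weight on `(0, ∞)`: a measurable function that is positive (and finite) a.e. on `(0, ∞)`. -/
def IsWeight (v : ℝ → ℝ≥0∞) : Prop :=
  Measurable v ∧ ∀ᵐ x ∂mu0, 0 < v x ∧ v x < ∞

section AtomlessMeasure

variable {ν : Measure ℝ} [IsFiniteMeasure ν]

theorem continuous_measure_Iic (hν : ∀ x, ν {x} = 0) : Continuous fun x => ν (Iic x) := by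
  refine continuous_iff_continuousAt.2 fun x => ?_
  refine tendsto_measure_of_ae_tendsto_indicator_of_isFiniteMeasure _ measurableSet_Iic
    (fun _ => measurableSet_Iic) ?_
  have hx : ∀ᵐ y ∂ν, y ≠ x := by
    rw [ae_iff]
    simpa using hν x
  filter_upwards [hx] with y hy
  rcases lt_or_gt_of_ne hy with h | h
  · filter_upwards [lt_mem_nhds h] with z hz
    simp [hz.le, h.le]
  · filter_upwards [gt_mem_nhds h] with z hz
    simp [not_le.2 hz, not_le.2 h]

theorem exists_measure_Iic_eq (hν : ∀ x, ν {x} = 0) {c : ℝ≥0∞} (hc : 0 < c)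
    (hcν : c < ν univ) : ∃ x, ν (Iic x) = c := by
  refine mem_range_of_exists_le_of_exists_ge (continuous_measure_Iic hν) ?_ ?_
  · have h : Filter.Tendsto (fun x : ℝ => ν (Iic x)) Filter.atBot (nhds (ν ∅)) := by
      refine tendsto_measure_of_ae_tendsto_indicator_of_isFiniteMeasure _ MeasurableSet.empty
        (fun _ => measurableSet_Iic) (Filter.Eventually.of_forall fun x => ?_)
      filter_upwards [Filter.eventually_lt_atBot x] with z hz
      simpa using hz
    rw [measure_empty] at h
    obtain ⟨x, hx⟩ := (h.eventually (gt_mem_nhds hc)).exists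
    exact ⟨x, hx.le⟩
  · obtain ⟨x, hx⟩ := ((tendsto_measure_Iic_atTop ν).eventually (lt_mem_nhds hcν)).exists
    exact ⟨x, hx.le⟩

/-- The distribution function of a finite atomless measure transports it to Lebesgue measure. -/
theorem map_measure_Iic_toReal (hν : ∀ x, ν {x} = 0) :
    ν.map (fun x => (ν (Iic x)).toReal) = volume.restrict (Ioc 0 (ν univ).toReal) := by
  have hmono : Monotone fun x => (ν (Iic x)).toReal := fun x y h =>
    ENNReal.toReal_mono (measure_ne_top _ _) (measure_mono (Iic_subset_Iic.2 h))
  have hmeas := hmono.measurable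
  refine Measure.ext_of_Iic _ _ fun y => ?_
  rw [Measure.map_apply hmeas measurableSet_Iic, Measure.restrict_apply measurableSet_Iic,
    inter_comm, Ioc_inter_Iic, Real.volume_Ioc, sub_zero]
  have key : ∀ z : ℝ, 0 < z → ENNReal.ofReal z < ν univ →
      ν ((fun x => (ν (Iic x)).toReal) ⁻¹' Iio z) ≤ ENNReal.ofReal z ∧
      ENNReal.ofReal z ≤ ν ((fun x => (ν (Iic x)).toReal) ⁻¹' Iic z) := by
    intro z hz hzν
    obtain ⟨x, hx⟩ := exists_measure_Iic_eq hν (ENNReal.ofReal_pos.2 hz) hzν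
    have hx' : (ν (Iic x)).toReal = z := by rw [hx, ENNReal.toReal_ofReal hz.le]
    constructor
    · rw [← hx]
      refine measure_mono fun t ht => ?_
      by_contra hxt
      have := hmono (not_le.1 hxt).le
      simp only [mem_preimage, mem_Iio] at ht this
      linarith
    · rw [← hx]
      refine measure_mono fun t ht => ?_
      have := hmono ht
      simp only [mem_preimage, mem_Iic] at this ⊢
      linarith
  rcases le_or_gt (ν univ).toReal y with hy | hy
  · rw [min_eq_left hy, ENNReal.ofReal_toReal (measure_ne_top _ _)]
    congr 1
    refine eq_univ_of_forall fun x => ?_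
    exact (ENNReal.toReal_mono (measure_ne_top _ _) (measure_mono (subset_univ _))).trans hy
  rw [min_eq_right hy.le]
  have hup : ∀ z : ℝ, 0 < z → y < z →
      ν ((fun x => (ν (Iic x)).toReal) ⁻¹' Iic y) ≤ ENNReal.ofReal z := by
    intro z hz hyz
    rcases lt_or_ge (ENNReal.ofReal z) (ν univ) with h | h
    · refine (measure_mono fun t ht => ?_).trans (key z hz h).1
      exact lt_of_le_of_lt ht hyz
    · exact (measure_mono (subset_univ _)).trans h
  refine le_antisymm ?_ ?_
  · have hlim : Filter.Tendsto (fun z : ℝ => ENNReal.ofReal z) (nhdsWithin (max y 0) (Ioi (max y 0)))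
        (nhds (ENNReal.ofReal (max y 0))) :=
      (ENNReal.continuous_ofReal.tendsto _).mono_left nhdsWithin_le_nhds
    have : ENNReal.ofReal y = ENNReal.ofReal (max y 0) := by simp
    rw [this]
    refine ge_of_tendsto hlim ?_
    filter_upwards [self_mem_nhdsWithin] with z hz
    exact hup z ((le_max_right _ _).trans_lt hz) ((le_max_left _ _).trans_lt hz)
  · rcases le_or_gt y 0 with h0 | h0
    · simp [ENNReal.ofReal_of_nonpos h0]
    · exact (key y h0 ((ENNReal.ofReal_lt_iff_lt_toReal h0.le (measure_ne_top _ _)).2 hy)).2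

theorem lintegral_Ioc_rpow_sub_one {M a : ℝ} (hM : 0 ≤ M) (ha : 0 < a) :
    ∫⁻ y in Ioc 0 M, ENNReal.ofReal y ^ (a - 1) = ENNReal.ofReal M ^ a / ENNReal.ofReal a := by
  have h1 : ∫⁻ y in Ioc 0 M, ENNReal.ofReal y ^ (a - 1)
      = ∫⁻ y in Ioc 0 M, ENNReal.ofReal (y ^ (a - 1)) :=
    setLIntegral_congr_fun measurableSet_Ioc fun y hy => ENNReal.ofReal_rpow_of_pos hy.1
  have hint : IntegrableOn (fun y : ℝ => y ^ (a - 1)) (Ioc 0 M) :=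
    (intervalIntegrable_iff_integrableOn_Ioc_of_le hM).1
      (intervalIntegral.intervalIntegrable_rpow' (by linarith))
  rw [h1, ← ofReal_integral_eq_lintegral_ofReal hint, ← intervalIntegral.integral_of_le hM,
    integral_rpow (Or.inl (by linarith)), ENNReal.ofReal_rpow_of_nonneg hM ha.le,
    ← ENNReal.ofReal_div_of_pos ha]
  · simp [Real.zero_rpow ha.ne']
  · filter_upwards [ae_restrict_mem measurableSet_Ioc] with y hy
    exact Real.rpow_nonneg hy.1.le _

theorem lintegral_rpow_measure_Iic (hν : ∀ x, ν {x} = 0) {a : ℝ} (ha : 0 < a) :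
    ∫⁻ x, ν (Iic x) ^ (a - 1) ∂ν = ν univ ^ a / ENNReal.ofReal a := by
  have hmono : Monotone fun x => (ν (Iic x)).toReal := fun x y h =>
    ENNReal.toReal_mono (measure_ne_top _ _) (measure_mono (Iic_subset_Iic.2 h))
  have h := lintegral_Ioc_rpow_sub_one (M := (ν univ).toReal) ENNReal.toReal_nonneg ha
  rw [← map_measure_Iic_toReal hν, lintegral_map (by fun_prop) hmono.measurable] at h
  simpa [ENNReal.ofReal_toReal (measure_ne_top _ _)] using h

theorem lintegral_rpow_measure_Ioi (hν : ∀ x, ν {x} = 0) {a : ℝ} (ha : 0 < a) :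
    ∫⁻ x, ν (Ioi x) ^ (a - 1) ∂ν = ν univ ^ a / ENNReal.ofReal a := by
  have hanti : Antitone fun x => ν (Ioi x) := fun x y h => measure_mono (Ioi_subset_Ioi h)
  have hI : ∀ x : ℝ, ν.map Neg.neg (Iic (-x)) = ν (Ioi x) := fun x => by
    rw [Measure.map_apply measurable_neg measurableSet_Iic]
    have : (Neg.neg ⁻¹' Iic (-x) : Set ℝ) = {x} ∪ Ioi x := by
      ext y; simp [le_iff_eq_or_lt]
    rw [this]
    exact measure_congr (union_ae_eq_right_of_ae_eq_empty (ae_eq_empty.2 (hν x)))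
  have hν' : ∀ x, ν.map Neg.neg {x} = 0 := fun x => by
    rw [Measure.map_apply measurable_neg (measurableSet_singleton x)]
    simpa using hν (-x)
  have h := lintegral_rpow_measure_Iic hν' ha
  have hm : Measurable fun x : ℝ => ν.map Neg.neg (Iic x) :=
    (show Monotone fun x : ℝ => ν.map Neg.neg (Iic x) from
      fun x y h => measure_mono (Iic_subset_Iic.2 h)).measurable
  rw [lintegral_map (hm.pow_const _) measurable_neg,
    Measure.map_apply measurable_neg MeasurableSet.univ] at h
  simpa [hI] using h

end AtomlessMeasure

section Density

variable {f : ℝ → ℝ≥0∞} {s : Set ℝ}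

theorem withDensity_restrict_apply (f : ℝ → ℝ≥0∞) (s : Set ℝ) {t : Set ℝ}
    (ht : MeasurableSet t) :
    (volume.restrict s).withDensity f t = ∫⁻ x in t ∩ s, f x := by
  rw [withDensity_apply _ ht, Measure.restrict_restrict ht]

theorem withDensity_restrict_singleton (f : ℝ → ℝ≥0∞) (s : Set ℝ) (x : ℝ) :
    (volume.restrict s).withDensity f {x} = 0 :=
  withDensity_absolutelyContinuous _ _ (by simp)

theorem withDensity_restrict_univ (f : ℝ → ℝ≥0∞) (s : Set ℝ) :
    (volume.restrict s).withDensity f univ = ∫⁻ x in s, f x := by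
  rw [withDensity_restrict_apply _ _ MeasurableSet.univ, univ_inter]

theorem antitone_setLIntegral_Ioi (f : ℝ → ℝ≥0∞) : Antitone fun x => ∫⁻ t in Ioi x, f t :=
  fun _ _ h => lintegral_mono_set (Ioi_subset_Ioi h)

theorem monotone_setLIntegral_Ioc (f : ℝ → ℝ≥0∞) (a : ℝ) :
    Monotone fun x => ∫⁻ t in Ioc a x, f t :=
  fun _ _ h => lintegral_mono_set (Ioc_subset_Ioc_right h)

theorem setLIntegral_rpow_tail (hf : Measurable f) {x b : ℝ} (hfin : ∫⁻ t in Ioi x, f t < ∞)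
    (hb : 0 < b) :
    ∫⁻ t in Ioi x, (∫⁻ τ in Ioi t, f τ) ^ (b - 1) * f t
      = (∫⁻ t in Ioi x, f t) ^ b / ENNReal.ofReal b := by
  set ν := (volume.restrict (Ioi x)).withDensity f
  have huniv : ν univ = ∫⁻ t in Ioi x, f t := withDensity_restrict_univ f _
  have : IsFiniteMeasure ν := ⟨huniv ▸ hfin⟩
  rw [← huniv, ← lintegral_rpow_measure_Ioi (withDensity_restrict_singleton f _) hb,
    lintegral_withDensity_eq_lintegral_mul _ hf]
  · refine setLIntegral_congr_fun measurableSet_Ioi fun t ht => ?_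
    have : ν (Ioi t) = ∫⁻ τ in Ioi t, f τ := by
      rw [withDensity_restrict_apply _ _ measurableSet_Ioi,
        inter_eq_left.2 (Ioi_subset_Ioi (le_of_lt ht))]
    rw [Pi.mul_apply, this, mul_comm]
  · exact (show Antitone fun t => ν (Ioi t) from
      fun _ _ h => measure_mono (Ioi_subset_Ioi h)).measurable.pow_const _

theorem setLIntegral_rpow_primitive (hf : Measurable f) (hfin : ∫⁻ t in s, f t < ∞)
    {a : ℝ} (ha : 0 < a) :
    ∫⁻ t in s, (∫⁻ τ in Iic t ∩ s, f τ) ^ (a - 1) * f t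
      = (∫⁻ t in s, f t) ^ a / ENNReal.ofReal a := by
  set ν := (volume.restrict s).withDensity f
  have huniv : ν univ = ∫⁻ t in s, f t := withDensity_restrict_univ f _
  have : IsFiniteMeasure ν := ⟨huniv ▸ hfin⟩
  rw [← huniv, ← lintegral_rpow_measure_Iic (withDensity_restrict_singleton f _) ha,
    lintegral_withDensity_eq_lintegral_mul _ hf]
  · refine lintegral_congr fun t => ?_
    rw [← withDensity_restrict_apply _ _ measurableSet_Iic]
    simp [mul_comm]
  · exact (show Monotone fun t => ν (Iic t) from
      fun _ _ h => measure_mono (Iic_subset_Iic.2 h)).measurable.pow_const _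

theorem exists_setLIntegral_Ioc_eq {x : ℝ} {c : ℝ≥0∞} (hfin : ∫⁻ t in Ioc 0 x, f t < ∞)
    (hc : 0 < c) (hcx : c ≤ ∫⁻ t in Ioc 0 x, f t) :
    ∃ y, 0 < y ∧ y ≤ x ∧ ∫⁻ t in Ioc 0 y, f t = c := by
  have hpos : ∀ y, ∫⁻ t in Ioc 0 y, f t = c → 0 < y := by
    intro y hy
    by_contra h
    rw [Ioc_eq_empty h] at hy
    simp [← hy] at hc
  rcases hcx.eq_or_lt with h | h
  · exact ⟨x, hpos x h.symm, le_rfl, h.symm⟩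
  set ν := (volume.restrict (Ioc 0 x)).withDensity f
  have huniv : ν univ = ∫⁻ t in Ioc 0 x, f t := withDensity_restrict_univ f _
  have : IsFiniteMeasure ν := ⟨huniv ▸ hfin⟩
  obtain ⟨y, hy⟩ := exists_measure_Iic_eq (withDensity_restrict_singleton f (Ioc 0 x)) hc
    (huniv ▸ h)
  rw [withDensity_restrict_apply _ _ measurableSet_Iic, inter_comm, Ioc_inter_Iic] at hy
  exact ⟨min x y, hpos _ hy, min_le_left _ _, hy⟩

theorem exists_setLIntegral_Ioi_eq {x : ℝ} {c : ℝ≥0∞} (hfin : ∫⁻ t in Ioi x, f t < ∞)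
    (hc : 0 < c) (hcx : c ≤ ∫⁻ t in Ioi x, f t) :
    ∃ y, x ≤ y ∧ ∫⁻ t in Ioi y, f t = c := by
  rcases hcx.eq_or_lt with h | h
  · exact ⟨x, le_rfl, h.symm⟩
  set ν := (volume.restrict (Ioi x)).withDensity f
  have huniv : ν univ = ∫⁻ t in Ioi x, f t := withDensity_restrict_univ f _
  have : IsFiniteMeasure ν := ⟨huniv ▸ hfin⟩
  obtain ⟨y, hy⟩ := exists_measure_Iic_eq (withDensity_restrict_singleton f (Ioi x))
    (tsub_pos_of_lt h) (ENNReal.sub_lt_self hfin.ne (hc.trans h).ne' hc.ne' |>.trans_eq huniv.symm)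
  have hy' : ν (Ioi y) = c := by
    rw [← compl_Iic, measure_compl measurableSet_Iic (measure_ne_top _ _), hy, huniv,
      ENNReal.sub_sub_cancel hfin.ne hcx]
  rw [withDensity_restrict_apply _ _ measurableSet_Ioi, Ioi_inter_Ioi] at hy'
  exact ⟨y ⊔ x, le_sup_right, hy'⟩

end Density

section Discretization

open scoped Function

theorem ENNReal.two_zpow_succ (k : ℤ) : (2 : ℝ≥0∞) ^ (k + 1) = 2 * 2 ^ k := by
  rw [ENNReal.zpow_add (by norm_num) (by norm_num), zpow_one, mul_comm]

theorem ENNReal.two_zpow_lt {k l : ℤ} (h : k < l) : (2 : ℝ≥0∞) ^ k < 2 ^ l := by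
  refine lt_of_lt_of_le ?_ (ENNReal.zpow_le_of_le (by norm_num) (Int.add_one_le_of_lt h))
  rw [ENNReal.two_zpow_succ, two_mul]
  exact ENNReal.lt_add_right (ENNReal.zpow_lt_top (by norm_num) (by norm_num) k).ne
    (ENNReal.zpow_pos (by norm_num) (by norm_num) k).ne'

theorem ENNReal.inner_le_Lp_mul_Lq_tsum {ι : Type*} [MeasurableSpace ι]
    [MeasurableSingletonClass ι] [Countable ι] {p q : ℝ} (hpq : p.HolderConjugate q)
    (f g : ι → ℝ≥0∞) :
    ∑' i, f i * g i ≤ (∑' i, f i ^ p) ^ (1 / p) * (∑' i, g i ^ q) ^ (1 / q) := by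
  have := ENNReal.lintegral_mul_le_Lp_mul_Lq Measure.count hpq
    (measurable_of_countable f).aemeasurable (measurable_of_countable g).aemeasurable
  simpa [lintegral_count] using this

theorem ENNReal.tsum_rpow_le_rpow_tsum {ι : Type*} {s : ℝ} (hs : 1 ≤ s) (f : ι → ℝ≥0∞) :
    ∑' i, f i ^ s ≤ (∑' i, f i) ^ s := by
  have hsplit : ∀ x : ℝ≥0∞, x ^ s = x * x ^ (s - 1) := fun x => by
    conv_lhs => rw [show s = 1 + (s - 1) by ring]
    rw [ENNReal.rpow_add_of_nonneg _ _ zero_le_one (by linarith), ENNReal.rpow_one]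
  rw [hsplit (∑' i, f i), ← ENNReal.tsum_mul_right]
  refine ENNReal.tsum_le_tsum fun i => ?_
  rw [hsplit]
  gcongr
  exact ENNReal.le_tsum i

/-- The density `v ^ (1 - p')` dual to the weight `v`. -/
def dualWeight (p : ℝ) (v : ℝ → ℝ≥0∞) : ℝ → ℝ≥0∞ := fun t => v t ^ (1 - p / (p - 1))

variable {p : ℝ} {v : ℝ → ℝ≥0∞}

theorem measurable_dualWeight (hv : IsWeight v) : Measurable (dualWeight p v) :=
  hv.1.pow_const _

theorem IsWeight.ae_restrict (hv : IsWeight v) {s : Set ℝ} (hs : s ⊆ Ioi 0) :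
    ∀ᵐ x ∂volume.restrict s, 0 < v x ∧ v x < ∞ :=
  ae_restrict_of_ae_restrict_of_subset hs hv.2

theorem setLIntegral_le_dualWeight (hp : 1 < p) (hv : IsWeight v) {h : ℝ → ℝ≥0∞}
    (hh : Measurable h) {s : Set ℝ} (hs : s ⊆ Ioi 0) :
    ∫⁻ t in s, h t ≤
      (∫⁻ t in s, h t ^ p * v t) ^ (1 / p) * (∫⁻ t in s, dualWeight p v t) ^ ((p - 1) / p) := by
  have hp0 : 0 < p := by linarith
  have hp1 : 0 < p - 1 := by linarith
  have hc : p.HolderConjugate (p / (p - 1)) := Real.HolderConjugate.conjExponent hp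
  have hvm := hv.1
  have H := ENNReal.lintegral_mul_le_Lp_mul_Lq (volume.restrict s) hc
    (f := fun t => h t * v t ^ (1 / p)) (g := fun t => v t ^ (-(1 / p)))
    (by fun_prop) (by fun_prop)
  refine le_trans (le_of_eq ?_) (H.trans (le_of_eq ?_))
  · refine lintegral_congr_ae ?_
    filter_upwards [hv.ae_restrict hs] with t ht
    rw [Pi.mul_apply, mul_assoc, ← ENNReal.rpow_add _ _ ht.1.ne' ht.2.ne]
    simp
  · congr 2
    · refine lintegral_congr fun t => ?_
      rw [ENNReal.mul_rpow_of_nonneg _ _ hp0.le, ← ENNReal.rpow_mul, one_div_mul_cancel hp0.ne',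
        ENNReal.rpow_one]
    · refine lintegral_congr fun t => ?_
      rw [← ENNReal.rpow_mul, dualWeight]
      congr 1
      field_simp
      ring
    · rw [one_div_div]

/-- The level set on which the tail integral of `h` lies in `(2 ^ k, 2 ^ (k + 1)]`. -/
def tailLevel (h : ℝ → ℝ≥0∞) (k : ℤ) : Set ℝ :=
  {t | 0 < t ∧ 2 ^ k < ∫⁻ s in Ioi t, h s ∧ ∫⁻ s in Ioi t, h s ≤ 2 ^ (k + 1)}

theorem measurableSet_tailLevel (h : ℝ → ℝ≥0∞) (k : ℤ) : MeasurableSet (tailLevel h k) := by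
  have hm := (antitone_setLIntegral_Ioi h).measurable
  exact measurableSet_Ioi.inter
    ((measurableSet_lt measurable_const hm).inter (measurableSet_le hm measurable_const))

theorem disjoint_tailLevel (h : ℝ → ℝ≥0∞) : Pairwise (Disjoint on tailLevel h) := by
  refine (pairwise_disjoint_on _).2 fun k l hkl => disjoint_left.2 fun t hk hl => ?_
  have h1 : (2 : ℝ≥0∞) ^ (k + 1) ≤ 2 ^ l := ENNReal.zpow_le_of_le (by norm_num) hkl
  exact absurd (hk.2.2.trans h1) (not_le.2 hl.2.1)

theorem setLIntegral_tail_rpow_le (μ : Measure ℝ) {h : ℝ → ℝ≥0∞} {r : ℝ} (hr : 0 < r)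
    {s : Set ℝ} (hs : s ⊆ Ioi 0) (hsm : MeasurableSet s)
    (hfin : ∀ t, 0 < t → ∫⁻ τ in Ioi t, h τ < ∞) :
    ∫⁻ t in s, (∫⁻ τ in Ioi t, h τ) ^ r ∂μ ≤
      ∑' k : ℤ, (2 ^ (k + 1) : ℝ≥0∞) ^ r * μ (tailLevel h k ∩ s) := by
  have hcov : s ⊆ (s ∩ {t | ∫⁻ τ in Ioi t, h τ = 0}) ∪ ⋃ k : ℤ, tailLevel h k ∩ s := by
    intro t ht
    rcases eq_or_ne (∫⁻ τ in Ioi t, h τ) 0 with h0 | h0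
    · exact Or.inl ⟨ht, h0⟩
    · obtain ⟨k, hk⟩ := ENNReal.exists_mem_Ioc_zpow h0 (hfin t (hs ht)).ne
        (by norm_num : (1 : ℝ≥0∞) < 2) (by norm_num)
      exact Or.inr (mem_iUnion.2 ⟨k, ⟨hs ht, hk⟩, ht⟩)
  refine (lintegral_mono_set hcov).trans ((lintegral_union_le _ _ _).trans ?_)
  have hzero : ∫⁻ t in s ∩ {t | ∫⁻ τ in Ioi t, h τ = 0}, (∫⁻ τ in Ioi t, h τ) ^ r ∂μ = 0 := by
    refine setLIntegral_eq_zero (hsm.inter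
      (measurableSet_eq_fun (antitone_setLIntegral_Ioi h).measurable measurable_const)) ?_
    intro t ht
    simp [show ∫⁻ τ in Ioi t, h τ = 0 from ht.2, hr]
  rw [hzero, zero_add]
  refine (lintegral_iUnion_le _ _).trans (ENNReal.tsum_le_tsum fun k => ?_)
  rw [← setLIntegral_const]
  refine setLIntegral_mono' ((measurableSet_tailLevel h k).inter hsm) fun t ht => ?_
  gcongr
  exact ht.1.2.2

theorem exists_tail_discretization (hp : 1 < p) (hv : IsWeight v) {h : ℝ → ℝ≥0∞}
    (hh : Measurable h) (hfin : ∀ t, 0 < t → ∫⁻ τ in Ioi t, h τ < ∞) :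
    ∃ (y : ℤ → ℝ) (a : ℤ → ℝ≥0∞), ∑' k, a k ^ p ≤ ∫⁻ t in Ioi 0, h t ^ p * v t ∧
      ∀ k, ∀ t ∈ tailLevel h k, t ≤ y k ∧
        2 ^ (k + 1) ≤ 4 * a k * (∫⁻ τ in Ioi (y k), dualWeight p v τ) ^ ((p - 1) / p) := by
  classical
  have hp0 : 0 < p := by linarith
  let P : ℤ → Prop := fun k => ∃ t, 0 < t ∧ 2 ^ k < ∫⁻ τ in Ioi t, h τ
  have hP : ∀ {k l : ℤ}, k ≤ l → P l → P k := fun hkl ⟨t, ht, hl⟩ =>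
    ⟨t, ht, (ENNReal.zpow_le_of_le (by norm_num) hkl).trans_lt hl⟩
  have hex : ∀ k, ∃ y : ℝ, P k → 0 < y ∧ ∫⁻ τ in Ioi y, h τ = 2 ^ k := by
    intro k
    by_cases hk : P k
    · obtain ⟨t, ht, hl⟩ := hk
      obtain ⟨y, hy, hy'⟩ := exists_setLIntegral_Ioi_eq (hfin t ht)
        (ENNReal.zpow_pos (by norm_num) (by norm_num) k) hl.le
      exact ⟨y, fun _ => ⟨ht.trans_le hy, hy'⟩⟩
    · exact ⟨0, fun h => absurd h hk⟩
  choose y hy using hex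
  have hlt : ∀ {k l : ℤ}, k < l → P l → y l < y k := by
    intro k l hkl hl
    by_contra hc
    have := antitone_setLIntegral_Ioi h (not_lt.1 hc)
    simp only [(hy l hl).2, (hy k (hP hkl.le hl)).2] at this
    exact absurd this (not_le.2 (ENNReal.two_zpow_lt hkl))
  let S : ℤ → Set ℝ := fun k => if P k then Ioc (y k) (y (k - 1)) else ∅
  have hSm : ∀ k, MeasurableSet (S k) := fun k => by
    by_cases hk : P k <;> simp [S, hk]
  have hSd : Pairwise (Disjoint on S) := by
    refine (pairwise_disjoint_on _).2 fun k l hkl => disjoint_left.2 fun t hk hl => ?_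
    by_cases hPl : P l
    · have hPk := hP hkl.le hPl
      simp only [S, hPl, hPk, if_true, mem_Ioc] at hk hl
      have : y (l - 1) ≤ y k := by
        rcases (Int.le_sub_one_of_lt hkl).eq_or_lt with h | h
        · rw [h]
        · exact (hlt h (hP (by omega) hPl)).le
      linarith
    · simp [S, hPl] at hl
  have hS0 : ∀ k, S k ⊆ Ioi 0 := fun k t ht => by
    by_cases hk : P k
    · simp only [S, hk, if_true, mem_Ioc] at ht
      exact (hy k hk).1.trans ht.1
    · simp [S, hk] at ht
  refine ⟨y, fun k => (∫⁻ t in S k, h t ^ p * v t) ^ (1 / p), ?_, ?_⟩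
  · simp_rw [← ENNReal.rpow_mul, one_div_mul_cancel hp0.ne', ENNReal.rpow_one]
    rw [← lintegral_iUnion hSm hSd]
    exact lintegral_mono_set (iUnion_subset hS0)
  · intro k t ht
    have hk : P k := ⟨t, ht.1, ht.2.1⟩
    have hk' : P (k - 1) := hP (by omega) hk
    refine ⟨?_, ?_⟩
    · by_contra hc
      have := antitone_setLIntegral_Ioi h (not_le.1 hc).le
      simp only [(hy k hk).2] at this
      exact absurd this (not_le.2 ht.2.1)
    have hyy : y k < y (k - 1) := hlt (by omega) hk
    have hSk : S k = Ioc (y k) (y (k - 1)) := by simp [S, hk]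
    have h2 : (2 : ℝ≥0∞) ^ k = 2 * 2 ^ (k - 1) := by
      rw [← ENNReal.two_zpow_succ, sub_add_cancel]
    have hfin2 : (2 : ℝ≥0∞) ^ (k - 1) ≠ ∞ := by
      rw [← (hy _ hk').2]; exact (hfin _ (hy _ hk').1).ne
    have hI : ∫⁻ t in S k, h t = 2 ^ (k - 1) := by
      have hsplit : ∫⁻ τ in Ioi (y k), h τ
          = (∫⁻ τ in S k, h τ) + ∫⁻ τ in Ioi (y (k - 1)), h τ := by
        rw [hSk, ← lintegral_union measurableSet_Ioi (Ioc_disjoint_Ioi le_rfl),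
          Ioc_union_Ioi_eq_Ioi hyy.le]
      rw [(hy k hk).2, (hy _ hk').2, h2, two_mul] at hsplit
      exact ((ENNReal.add_left_inj hfin2).1 hsplit).symm
    have h4 : (2 : ℝ≥0∞) ^ (k + 1) = 4 * 2 ^ (k - 1) := by
      rw [ENNReal.two_zpow_succ, h2, ← mul_assoc]
      norm_num
    rw [h4, ← hI, mul_assoc]
    gcongr
    refine (setLIntegral_le_dualWeight hp hv hh (hS0 k)).trans ?_
    gcongr
    rw [hSk]
    exact Ioc_subset_Ioi_self

end Discretization

section Hardy

open scoped Function

variable {p q r : ℝ} {u v h : ℝ → ℝ≥0∞}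

theorem tail_lt_top (hp : 1 < p) (hv : IsWeight v)
    (hvfin : ∀ x, 0 < x → ∫⁻ t in Ioi x, dualWeight p v t < ∞) (hh : Measurable h)
    (hN : ∫⁻ t in Ioi 0, h t ^ p * v t < ∞) {t : ℝ} (ht : 0 < t) :
    ∫⁻ τ in Ioi t, h τ < ∞ := by
  have hs : Ioi t ⊆ Ioi 0 := Ioi_subset_Ioi ht.le
  refine (setLIntegral_le_dualWeight hp hv hh hs).trans_lt ?_
  refine ENNReal.mul_lt_top (ENNReal.rpow_lt_top_of_nonneg (by positivity) ?_)
    (ENNReal.rpow_lt_top_of_nonneg (by positivity) (hvfin t ht).ne)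
  exact ((lintegral_mono_set hs).trans_lt hN).ne

/-- Hardy's inequality with respect to a measure, in the range `p ≤ q`. -/
theorem lintegral_tail_rpow_le_of_le (hp : 1 < p) (hpq : p ≤ q) (hv : IsWeight v)
    (hh : Measurable h) (hfin : ∀ t, 0 < t → ∫⁻ τ in Ioi t, h τ < ∞) (μ : Measure ℝ)
    {B : ℝ≥0∞} (hμ : ∀ t, 0 < t →
      μ (Ioc 0 t) * (∫⁻ τ in Ioi t, dualWeight p v τ) ^ ((p - 1) / p * q) ≤ B) :
    ∫⁻ t in Ioi 0, (∫⁻ τ in Ioi t, h τ) ^ q ∂μ ≤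
      4 ^ q * B * (∫⁻ t in Ioi 0, h t ^ p * v t) ^ (q / p) := by
  have hp0 : 0 < p := by linarith
  have hq0 : 0 < q := by linarith
  obtain ⟨y, a, ha, hya⟩ := exists_tail_discretization hp hv hh hfin
  refine (setLIntegral_tail_rpow_le μ hq0 subset_rfl measurableSet_Ioi hfin).trans ?_
  calc ∑' k : ℤ, (2 ^ (k + 1) : ℝ≥0∞) ^ q * μ (tailLevel h k ∩ Ioi 0)
      ≤ ∑' k : ℤ, 4 ^ q * B * (a k ^ p) ^ (q / p) := by
        refine ENNReal.tsum_le_tsum fun k => ?_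
        rcases (tailLevel h k).eq_empty_or_nonempty with hk | ⟨t, ht⟩
        · simp [hk]
        have hy0 : 0 < y k := ht.1.trans_le (hya k t ht).1
        have hsub : tailLevel h k ∩ Ioi 0 ⊆ Ioc 0 (y k) := fun s hs => ⟨hs.2, (hya k s hs.1).1⟩
        calc (2 ^ (k + 1) : ℝ≥0∞) ^ q * μ (tailLevel h k ∩ Ioi 0)
            ≤ (4 * a k * (∫⁻ τ in Ioi (y k), dualWeight p v τ) ^ ((p - 1) / p)) ^ q
              * μ (Ioc 0 (y k)) := by
              gcongr
              exact (hya k t ht).2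
          _ = 4 ^ q * (μ (Ioc 0 (y k)) *
                (∫⁻ τ in Ioi (y k), dualWeight p v τ) ^ ((p - 1) / p * q)) * a k ^ q := by
              rw [ENNReal.mul_rpow_of_nonneg _ _ hq0.le, ENNReal.mul_rpow_of_nonneg _ _ hq0.le,
                ← ENNReal.rpow_mul]
              ring
          _ ≤ 4 ^ q * B * (a k ^ p) ^ (q / p) := by
              rw [← ENNReal.rpow_mul, mul_div_cancel₀ _ hp0.ne']
              gcongr
              exact hμ _ hy0
    _ ≤ 4 ^ q * B * (∫⁻ t in Ioi 0, h t ^ p * v t) ^ (q / p) := by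
        rw [ENNReal.tsum_mul_left]
        gcongr
        refine (ENNReal.tsum_rpow_le_rpow_tsum ((one_le_div hp0).2 hpq) _).trans ?_
        gcongr

/-- The Maz'ya–Rozin–Sinnamon functional of the weighted Hardy inequality on `(x₀, ∞)` in the
range `r < p`. -/
def hardyIntegral (p r : ℝ) (u v : ℝ → ℝ≥0∞) (x₀ : ℝ) : ℝ≥0∞ :=
  ∫⁻ x in Ioi x₀, (∫⁻ τ in Ioc x₀ x, u τ) ^ (r / (p - r)) * u x *
    (∫⁻ τ in Ioi x, dualWeight p v τ) ^ ((p - 1) * r / (p - r))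

/-- The weighted Hardy inequality on `(x₀, ∞)` in the range `r < p`. -/
theorem lintegral_tail_rpow_mul_le (hp : 1 < p) (hr : 0 < r) (hrp : r < p) (hu : Measurable u)
    (hv : IsWeight v) (hh : Measurable h) (hfin : ∀ t, 0 < t → ∫⁻ τ in Ioi t, h τ < ∞)
    {x₀ : ℝ} (hx₀ : 0 < x₀) (hufin : ∀ s, ∫⁻ τ in Ioc x₀ s, u τ < ∞) :
    ∫⁻ t in Ioi x₀, (∫⁻ τ in Ioi t, h τ) ^ r * u t ≤
      4 ^ r * (∫⁻ t in Ioi 0, h t ^ p * v t) ^ (r / p) *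
        (ENNReal.ofReal (p / (p - r)) * hardyIntegral p r u v x₀) ^ ((p - r) / p) := by
  have hp0 : 0 < p := by linarith
  have hpr : 0 < p - r := by linarith
  have hp1 : 0 < p - 1 := by linarith
  obtain ⟨y, a, ha, hya⟩ := exists_tail_discretization hp hv hh hfin
  set V : ℝ → ℝ≥0∞ := fun x => ∫⁻ τ in Ioi x, dualWeight p v τ with hV
  have hVanti : Antitone V := antitone_setLIntegral_Ioi _
  set A : ℤ → Set ℝ := fun k => tailLevel h k ∩ Ioi x₀ with hA
  have hAm : ∀ k, MeasurableSet (A k) := fun k =>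
    (measurableSet_tailLevel h k).inter measurableSet_Ioi
  set b : ℤ → ℝ≥0∞ := fun k => V (y k) ^ ((p - 1) / p * r) * ∫⁻ t in A k, u t with hb
  have hs : Ioi x₀ ⊆ Ioi 0 := Ioi_subset_Ioi hx₀.le
  have hstart : ∫⁻ t in Ioi x₀, (∫⁻ τ in Ioi t, h τ) ^ r * u t ≤
      4 ^ r * ∑' k, a k ^ r * b k := by
    have h1 := setLIntegral_tail_rpow_le (volume.withDensity u) hr hs measurableSet_Ioi hfin
    rw [restrict_withDensity measurableSet_Ioi, lintegral_withDensity_eq_lintegral_mul _ hu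
      ((antitone_setLIntegral_Ioi h).measurable.pow_const r)] at h1
    refine (le_of_eq (lintegral_congr fun t => mul_comm _ _)).trans (h1.trans ?_)
    rw [← ENNReal.tsum_mul_left]
    refine ENNReal.tsum_le_tsum fun k => ?_
    rw [withDensity_apply _ (hAm k)]
    rcases (tailLevel h k).eq_empty_or_nonempty with hk | ⟨t, ht⟩
    · simp [hA, hk]
    calc (2 ^ (k + 1) : ℝ≥0∞) ^ r * ∫⁻ t in A k, u t
        ≤ (4 * a k * V (y k) ^ ((p - 1) / p)) ^ r * ∫⁻ t in A k, u t := by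
          gcongr
          exact (hya k t ht).2
      _ = 4 ^ r * (a k ^ r * b k) := by
          rw [ENNReal.mul_rpow_of_nonneg _ _ hr.le, ENNReal.mul_rpow_of_nonneg _ _ hr.le,
            ← ENNReal.rpow_mul, hb]
          ring
  have hholder : ∑' k, a k ^ r * b k ≤
      (∑' k, a k ^ p) ^ (r / p) * (∑' k, b k ^ (p / (p - r))) ^ ((p - r) / p) := by
    have hc : (p / r).HolderConjugate (p / (p - r)) := by
      rw [Real.holderConjugate_iff]
      refine ⟨(one_lt_div hr).2 hrp, ?_⟩
      field_simp
      ring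
    have := ENNReal.inner_le_Lp_mul_Lq_tsum hc (fun k => a k ^ r) b
    simpa only [← ENNReal.rpow_mul, mul_div_cancel₀ p hr.ne', one_div_div] using this
  have hterm : ∀ k, b k ^ (p / (p - r)) ≤ ENNReal.ofReal (p / (p - r)) *
      ∫⁻ x in A k, (∫⁻ τ in Ioc x₀ x, u τ) ^ (r / (p - r)) * u x *
        V x ^ ((p - 1) * r / (p - r)) := by
    intro k
    rcases (A k).eq_empty_or_nonempty with hk | ⟨t, ht⟩
    · simp [hb, hk, hpr, hp0]
    have hAy : A k ⊆ Ioc x₀ (y k) := fun s hs => ⟨hs.2, (hya k s hs.1).1⟩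
    have hAfin : ∫⁻ t in A k, u t < ∞ := (lintegral_mono_set hAy).trans_lt (hufin _)
    have hQ : 0 < p / (p - r) := by positivity
    have hprim := setLIntegral_rpow_primitive hu hAfin hQ
    have hQ1 : p / (p - r) - 1 = r / (p - r) := by field_simp; ring
    have hmul : ENNReal.ofReal (p / (p - r)) *
        ((∫⁻ t in A k, u t) ^ (p / (p - r)) / ENNReal.ofReal (p / (p - r)))
          = (∫⁻ t in A k, u t) ^ (p / (p - r)) :=
      ENNReal.mul_div_cancel (by simpa using hQ) ENNReal.ofReal_ne_top
    rw [hb, ENNReal.mul_rpow_of_nonneg _ _ hQ.le, ← hmul, ← hprim, ← ENNReal.rpow_mul,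
      mul_left_comm, hQ1]
    gcongr ENNReal.ofReal _ * ?_
    refine (lintegral_const_mul_le _ _).trans (setLIntegral_mono' (hAm k) fun x hx => ?_)
    rw [mul_comm, show (p - 1) / p * r * (p / (p - r)) = (p - 1) * r / (p - r) by field_simp]
    gcongr ?_ ^ _ * _ * ?_ ^ _
    · exact lintegral_mono_set fun s hs => ⟨hs.2.2, hs.1⟩
    · exact hVanti (hAy hx).2
  refine hstart.trans ?_
  rw [mul_assoc]
  gcongr
  refine hholder.trans ?_
  gcongr
  calc ∑' k, b k ^ (p / (p - r)) ≤ ∑' k, ENNReal.ofReal (p / (p - r)) *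
      ∫⁻ x in A k, (∫⁻ τ in Ioc x₀ x, u τ) ^ (r / (p - r)) * u x *
        V x ^ ((p - 1) * r / (p - r)) := ENNReal.tsum_le_tsum hterm
    _ ≤ ENNReal.ofReal (p / (p - r)) * hardyIntegral p r u v x₀ := by
      rw [ENNReal.tsum_mul_left, ← lintegral_iUnion hAm]
      · gcongr
        exact lintegral_mono_set (iUnion_subset fun k => inter_subset_right)
      · exact fun i j hij => (disjoint_tailLevel h hij).mono inter_subset_left inter_subset_left

end Hardy

section Necessity

variable {p q r : ℝ} {u v h : ℝ → ℝ≥0∞}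

theorem lintegral_primitive_mul {f g : ℝ → ℝ≥0∞} (hf : Measurable f) (hg : Measurable g)
    (x₀ : ℝ) :
    ∫⁻ s in Ioi x₀, (∫⁻ x in Ioc x₀ s, f x) * g s =
      ∫⁻ x in Ioi x₀, f x * ∫⁻ s in Ioi x, g s := by
  have hT : MeasurableSet {z : ℝ × ℝ | z.2 ≤ z.1} := measurableSet_le measurable_snd measurable_fst
  have hm : Measurable ({z : ℝ × ℝ | z.2 ≤ z.1}.indicator fun z => f z.2 * g z.1) :=
    Measurable.indicator (by fun_prop) hT
  calc ∫⁻ s in Ioi x₀, (∫⁻ x in Ioc x₀ s, f x) * g s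
      = ∫⁻ s in Ioi x₀, ∫⁻ x in Ioi x₀,
          {z : ℝ × ℝ | z.2 ≤ z.1}.indicator (fun z => f z.2 * g z.1) (s, x) := by
        refine lintegral_congr fun s => ?_
        rw [← lintegral_mul_const _ hf, ← Ioi_inter_Iic, inter_comm,
          ← setLIntegral_indicator measurableSet_Iic]
        rfl
    _ = ∫⁻ x in Ioi x₀, ∫⁻ s in Ioi x₀,
          {z : ℝ × ℝ | z.2 ≤ z.1}.indicator (fun z => f z.2 * g z.1) (s, x) :=
        lintegral_lintegral_swap hm.aemeasurable
    _ = ∫⁻ x in Ioi x₀, f x * ∫⁻ s in Ioi x, g s := by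
        refine setLIntegral_congr_fun measurableSet_Ioi fun x hx => ?_
        have hx' : Ici x ∩ Ioi x₀ = Ici x :=
          inter_eq_left.2 fun s (hs : x ≤ s) => mem_Ioi.2 (lt_of_lt_of_le (mem_Ioi.1 hx) hs)
        rw [setLIntegral_congr (Ioi_ae_eq_Ici (a := x)), ← lintegral_const_mul _ hg]
        conv_rhs => rw [← hx', ← setLIntegral_indicator measurableSet_Ici]
        rfl

theorem dualWeight_rpow_mul (hp : 1 < p) {t : ℝ} (ht : 0 < v t ∧ v t < ∞) :
    dualWeight p v t ^ p * v t = dualWeight p v t := by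
  have hp1 : 0 < p - 1 := by linarith
  rw [dualWeight, ← ENNReal.rpow_mul]
  conv_lhs => rw [← ENNReal.rpow_one (v t), ← ENNReal.rpow_mul,
    ← ENNReal.rpow_add _ _ ht.1.ne' ht.2.ne]
  congr 1
  field_simp
  ring

theorem mul_hardyIntegral_rpow_le_of_lt_top (hp : 1 < p) (hr : 0 < r) (hrp : r < p) (hu : Measurable u)
    (hv : IsWeight v) {x₀ : ℝ} (hx₀ : 0 < x₀)
    (hvfin : ∀ x, x₀ ≤ x → ∫⁻ t in Ioi x, dualWeight p v t < ∞)
    (hufin : ∀ s, ∫⁻ τ in Ioc x₀ s, u τ < ∞) (hE : hardyIntegral p r u v x₀ < ∞) {K C : ℝ≥0∞}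
    (hK : ∀ h : ℝ → ℝ≥0∞, Measurable h →
      K * (∫⁻ t in Ioi x₀, (∫⁻ s in Ioi t, h s) ^ r * u t) ^ (1 / r) ≤
        C * (∫⁻ t in Ioi 0, h t ^ p * v t) ^ (1 / p)) :
    K * hardyIntegral p r u v x₀ ^ ((p - r) / (p * r)) ≤
      C * (ENNReal.ofReal ((p - 1) / (p - r)) *
        (ENNReal.ofReal (p / (p - r)) / ENNReal.ofReal ((p - 1) * r / (p - r))) ^ (1 / p)) := by
  have hp0 : 0 < p := by linarith
  have hpr : 0 < p - r := by linarith
  have hp1 : 0 < p - 1 := by linarith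
  set E := hardyIntegral p r u v x₀ with hEdef
  rcases eq_or_ne E 0 with hE0 | hE0
  · rw [hE0, ENNReal.zero_rpow_of_pos (by positivity)]
    simp
  set σ := dualWeight p v with hσ
  have hσm : Measurable σ := measurable_dualWeight hv
  set U : ℝ → ℝ≥0∞ := fun x => ∫⁻ τ in Ioc x₀ x, u τ with hU
  set V : ℝ → ℝ≥0∞ := fun x => ∫⁻ τ in Ioi x, σ τ with hV
  have hUm : Monotone U := monotone_setLIntegral_Ioc u x₀
  have hVm : Antitone V := antitone_setLIntegral_Ioi σ
  have hUme := hUm.measurable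
  have hVme := hVm.measurable
  have hEeq : E = ∫⁻ x in Ioi x₀, U x ^ (r / (p - r)) * u x * V x ^ ((p - 1) * r / (p - r)) := rfl
  set m := (p - 1) / (p - r) with hm
  set Q := p / (p - r) with hQ
  set b := (p - 1) * r / (p - r) with hb
  have hm0 : 0 < m := by positivity
  have hQ0 : 0 < Q := by positivity
  have hb0 : 0 < b := by positivity
  set φ : ℝ → ℝ≥0∞ := fun s => U s ^ (1 / (p - r)) * V s ^ (m - 1) * σ s with hφ
  have hφm : Measurable φ := by fun_prop
  have hright : ∫⁻ t in Ioi 0, (Ioi x₀).indicator φ t ^ p * v t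
      = ENNReal.ofReal Q / ENNReal.ofReal b * E := by
    have h1 : ∫⁻ t in Ioi 0, (Ioi x₀).indicator φ t ^ p * v t
        = ∫⁻ t in Ioi x₀, U t ^ Q * (V t ^ (b - 1) * σ t) := by
      have : ∀ t, (Ioi x₀).indicator φ t ^ p * v t
          = (Ioi x₀).indicator (fun t => φ t ^ p * v t) t := fun t => by
        by_cases ht : t ∈ Ioi x₀ <;> simp [ht, hp0]
      simp_rw [this]
      rw [setLIntegral_indicator measurableSet_Ioi, inter_eq_left.2 (Ioi_subset_Ioi hx₀.le)]
      refine lintegral_congr_ae ?_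
      filter_upwards [hv.ae_restrict (Ioi_subset_Ioi hx₀.le)] with t ht
      rw [hφ]
      simp only
      rw [ENNReal.mul_rpow_of_nonneg _ _ hp0.le, ENNReal.mul_rpow_of_nonneg _ _ hp0.le,
        mul_assoc _ (σ t ^ p), hσ, dualWeight_rpow_mul hp ht, ← ENNReal.rpow_mul,
        ← ENNReal.rpow_mul, mul_assoc, show 1 / (p - r) * p = Q by rw [hQ]; field_simp,
        show (m - 1) * p = b - 1 by rw [hm, hb]; field_simp; ring]
    have h2 : ∀ t, U t ^ Q = ENNReal.ofReal Q * ∫⁻ x in Ioc x₀ t, U x ^ (r / (p - r)) * u x := by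
      intro t
      have := setLIntegral_rpow_primitive hu (hufin t) hQ0
      have hQ1 : Q - 1 = r / (p - r) := by rw [hQ]; field_simp; ring
      have hcongr : ∫⁻ x in Ioc x₀ t, U x ^ (r / (p - r)) * u x
          = ∫⁻ x in Ioc x₀ t, (∫⁻ τ in Iic x ∩ Ioc x₀ t, u τ) ^ (Q - 1) * u x := by
        refine setLIntegral_congr_fun measurableSet_Ioc fun x hx => ?_
        rw [inter_comm, Ioc_inter_Iic, min_eq_right hx.2, hQ1]
      rw [hcongr, this, ENNReal.mul_div_cancel (by simpa using hQ0) ENNReal.ofReal_ne_top]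
    rw [h1]
    simp_rw [h2, mul_assoc]
    rw [lintegral_const_mul' _ _ ENNReal.ofReal_ne_top,
      lintegral_primitive_mul (by fun_prop) (by fun_prop)]
    have h3 : ∫⁻ x in Ioi x₀, U x ^ (r / (p - r)) * u x * ∫⁻ s in Ioi x, V s ^ (b - 1) * σ s
        = ∫⁻ x in Ioi x₀, U x ^ (r / (p - r)) * u x * V x ^ b * (ENNReal.ofReal b)⁻¹ := by
      refine setLIntegral_congr_fun measurableSet_Ioi fun x hx => ?_
      have hb' : ∫⁻ s in Ioi x, V s ^ (b - 1) * σ s = V x ^ b / ENNReal.ofReal b :=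
        setLIntegral_rpow_tail hσm (hvfin x (le_of_lt hx)) hb0
      rw [hb', div_eq_mul_inv (V x ^ b), ← mul_assoc]
    rw [h3, lintegral_mul_const _ (by fun_prop), ← hEeq, div_eq_mul_inv]
    ring
  have hleft : E / ENNReal.ofReal m ^ r ≤
      ∫⁻ t in Ioi x₀, (∫⁻ s in Ioi t, (Ioi x₀).indicator φ s) ^ r * u t := by
    rw [div_eq_mul_inv, hEeq, ← lintegral_mul_const _ (by fun_prop)]
    refine setLIntegral_mono' measurableSet_Ioi fun x hx => ?_
    have hH : U x ^ (1 / (p - r)) * (V x ^ m / ENNReal.ofReal m) ≤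
        ∫⁻ s in Ioi x, (Ioi x₀).indicator φ s := by
      have hm' : ∫⁻ s in Ioi x, V s ^ (m - 1) * σ s = V x ^ m / ENNReal.ofReal m :=
        setLIntegral_rpow_tail hσm (hvfin x (le_of_lt hx)) hm0
      rw [← hm', ← lintegral_const_mul _ (by fun_prop)]
      refine setLIntegral_mono' measurableSet_Ioi fun s hs => ?_
      rw [indicator_of_mem (mem_Ioi.2 (lt_trans (mem_Ioi.1 hx) (mem_Ioi.1 hs))), ← mul_assoc]
      have hUs : U x ≤ U s := hUm (le_of_lt hs)
      change U x ^ (1 / (p - r)) * V s ^ (m - 1) * σ s ≤ U s ^ (1 / (p - r)) * V s ^ (m - 1) * σ s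
      gcongr
    calc U x ^ (r / (p - r)) * u x * V x ^ b * (ENNReal.ofReal m ^ r)⁻¹
        = (U x ^ (1 / (p - r)) * (V x ^ m / ENNReal.ofReal m)) ^ r * u x := by
          rw [ENNReal.mul_rpow_of_nonneg _ _ hr.le, ENNReal.div_rpow_of_nonneg _ _ hr.le,
            ← ENNReal.rpow_mul, ← ENNReal.rpow_mul,
            show 1 / (p - r) * r = r / (p - r) by ring,
            show m * r = b by rw [hm, hb]; ring, div_eq_mul_inv (V x ^ b)]
          ring
      _ ≤ _ := by gcongr
  have hmain := hK ((Ioi x₀).indicator φ) (hφm.indicator measurableSet_Ioi)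
  rw [hright] at hmain
  replace hmain := (mul_le_mul_right (ENNReal.rpow_le_rpow hleft (one_div_nonneg.2 hr.le)) K).trans hmain
  have hcan0 : E ^ (1 / p) ≠ 0 := (ENNReal.rpow_pos (pos_iff_ne_zero.2 hE0) hE.ne).ne'
  have hcan1 : E ^ (1 / p) ≠ ∞ := (ENNReal.rpow_lt_top_of_nonneg (by positivity) hE.ne).ne
  have hmr0 : ENNReal.ofReal m ≠ 0 := by simpa using hm0
  rw [ENNReal.div_rpow_of_nonneg _ _ (by positivity), ← ENNReal.rpow_mul,
    mul_one_div_cancel hr.ne', ENNReal.rpow_one, ENNReal.mul_rpow_of_nonneg _ _ (by positivity),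
    show 1 / r = (p - r) / (p * r) + 1 / p by field_simp; ring,
    ENNReal.rpow_add _ _ hE0 hE.ne] at hmain
  refine (ENNReal.mul_le_mul_iff_left hcan0 hcan1).1 ?_
  calc K * E ^ ((p - r) / (p * r)) * E ^ (1 / p)
      = ENNReal.ofReal m * (K * (E ^ ((p - r) / (p * r)) * E ^ (1 / p) / ENNReal.ofReal m)) := by
        rw [mul_left_comm, ENNReal.mul_div_cancel hmr0 ENNReal.ofReal_ne_top, mul_assoc]
    _ ≤ ENNReal.ofReal m *
        (C * ((ENNReal.ofReal Q / ENNReal.ofReal b) ^ (1 / p) * E ^ (1 / p))) := by gcongr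
    _ = _ := by ring

end Necessity

section LocalFiniteness

variable {p q r : ℝ} {u v w f : ℝ → ℝ≥0∞}

theorem setLIntegral_ne_zero_of_ae_pos (hf : Measurable f) {s : Set ℝ}
    (hpos : ∀ᵐ x ∂volume.restrict s, 0 < f x) (hs : volume s ≠ 0) : ∫⁻ x in s, f x ≠ 0 := by
  intro h0
  have hfalse : ∀ᵐ _ ∂volume.restrict s, False := by
    filter_upwards [(lintegral_eq_zero_iff hf).1 h0, hpos] with x hx hx'
    exact hx'.ne' hx
  rw [Filter.eventually_false_iff_eq_bot, ae_eq_bot, Measure.restrict_eq_zero] at hfalse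
  exact hs hfalse

theorem IsWeight.setLIntegral_Ioc_ne_zero (hu : IsWeight u) {a b : ℝ} (ha : 0 ≤ a) (hab : a < b) :
    ∫⁻ x in Ioc a b, u x ≠ 0 := by
  refine setLIntegral_ne_zero_of_ae_pos hu.1 ?_ (by simpa using hab)
  have hs : Ioc a b ⊆ Ioi 0 := fun x hx => lt_of_le_of_lt ha hx.1
  filter_upwards [hu.ae_restrict hs] with x hx using hx.1

theorem IsWeight.setLIntegral_Ioi_dualWeight_ne_zero (hv : IsWeight v) {t : ℝ} (ht : 0 ≤ t) :
    ∫⁻ x in Ioi t, dualWeight p v x ≠ 0 := by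
  refine setLIntegral_ne_zero_of_ae_pos (measurable_dualWeight hv) ?_ (by simp)
  filter_upwards [hv.ae_restrict (Ioi_subset_Ioi ht)] with x hx using
    ENNReal.rpow_pos hx.1 hx.2.ne

theorem setLIntegral_Ioc_lt_top_of_lintegral (hw : IsWeight w) (hrq : 0 < q / r) {s t : ℝ}
    (hs : 0 < s) (hE : ∫⁻ x in Ioc 0 t, w x * (∫⁻ τ in Ioc x t, u τ) ^ (q / r) < ∞) :
    ∫⁻ τ in Ioc s t, u τ < ∞ := by
  rcases le_or_gt t s with hts | hst
  · simp [Ioc_eq_empty_of_le hts]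
  by_contra hcon
  rw [not_lt, top_le_iff] at hcon
  refine hE.ne (top_le_iff.1 ?_)
  calc (∞ : ℝ≥0∞) = ∫⁻ x in Ioc 0 s, w x * ∞ := by
        rw [lintegral_mul_const _ hw.1, ENNReal.mul_top (hw.setLIntegral_Ioc_ne_zero le_rfl hs)]
    _ ≤ ∫⁻ x in Ioc 0 s, w x * (∫⁻ τ in Ioc x t, u τ) ^ (q / r) := by
        refine setLIntegral_mono' measurableSet_Ioc fun x hx => ?_
        have : ∫⁻ τ in Ioc x t, u τ = ∞ :=
          top_le_iff.1 (hcon.symm.le.trans (lintegral_mono_set (Ioc_subset_Ioc_left hx.2)))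
        rw [this, ENNReal.top_rpow_of_pos hrq]
    _ ≤ _ := lintegral_mono_set (Ioc_subset_Ioc_right hst.le)

theorem hardyIntegral_ne_zero (hp : 1 < p) (hr : 0 < r) (hrp : r < p) (hu : IsWeight u)
    (hv : IsWeight v) (hvfin : ∀ x, 0 < x → ∫⁻ t in Ioi x, dualWeight p v t < ∞) {x₀ : ℝ}
    (hx₀ : 0 < x₀) : hardyIntegral p r u v x₀ ≠ 0 := by
  have hpr : 0 < p - r := by linarith
  have hp1 : 0 < p - 1 := by linarith
  have h1 := (monotone_setLIntegral_Ioc u x₀).measurable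
  have h2 := (antitone_setLIntegral_Ioi (dualWeight p v)).measurable
  have hum := hu.1
  refine setLIntegral_ne_zero_of_ae_pos (by fun_prop) ?_ (by simp)
  filter_upwards [hu.ae_restrict (Ioi_subset_Ioi hx₀.le), ae_restrict_mem measurableSet_Ioi]
    with x hx hxx
  have hx0 : 0 < x := hx₀.trans hxx
  refine ENNReal.mul_pos (mul_ne_zero ?_ hx.1.ne') ?_
  · exact (ENNReal.rpow_eq_zero_iff_of_pos (by positivity)).not.2
      (hu.setLIntegral_Ioc_ne_zero hx₀.le hxx)
  · exact (ENNReal.rpow_pos (pos_iff_ne_zero.2 (hv.setLIntegral_Ioi_dualWeight_ne_zero hx0.le))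
      (hvfin x hx0).ne).ne'

end LocalFiniteness

section NecessityGeneral

variable {p q r : ℝ} {u v w : ℝ → ℝ≥0∞}

theorem mul_hardyIntegral_rpow_le (hp : 1 < p) (hr : 0 < r) (hrp : r < p) (hu : Measurable u)
    (hv : IsWeight v) {x₀ : ℝ} (hx₀ : 0 < x₀)
    (hvfin : ∀ x, x₀ ≤ x → ∫⁻ t in Ioi x, dualWeight p v t < ∞)
    (hufin : ∀ s, ∫⁻ τ in Ioc x₀ s, u τ < ∞) {K C : ℝ≥0∞}
    (hK : ∀ h : ℝ → ℝ≥0∞, Measurable h →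
      K * (∫⁻ t in Ioi x₀, (∫⁻ s in Ioi t, h s) ^ r * u t) ^ (1 / r) ≤
        C * (∫⁻ t in Ioi 0, h t ^ p * v t) ^ (1 / p)) :
    K * hardyIntegral p r u v x₀ ^ ((p - r) / (p * r)) ≤
      C * (ENNReal.ofReal ((p - 1) / (p - r)) *
        (ENNReal.ofReal (p / (p - r)) / ENNReal.ofReal ((p - 1) * r / (p - r))) ^ (1 / p)) := by
  have hp0 : 0 < p := by linarith
  have hpr : 0 < p - r := by linarith
  have hp1 : 0 < p - 1 := by linarith
  have h1 := (monotone_setLIntegral_Ioc u x₀).measurable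
  have h2 := (antitone_setLIntegral_Ioi (dualWeight p v)).measurable
  have he : 0 < (p - r) / (p * r) := by positivity
  set F : ℝ → ℝ≥0∞ := fun x => (∫⁻ τ in Ioc x₀ x, u τ) ^ (r / (p - r)) * u x *
    (∫⁻ τ in Ioi x, dualWeight p v τ) ^ ((p - 1) * r / (p - r)) with hF
  have hFm : Measurable F := by fun_prop
  rcases eq_or_ne (hardyIntegral p r u v x₀) 0 with h0 | h0
  · rw [h0, ENNReal.zero_rpow_of_pos he]
    simp
  have htrunc : ∀ y : ℝ, hardyIntegral p r ((Iic y).indicator u) v x₀ =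
      ∫⁻ x in Iic y, F x ∂volume.restrict (Ioi x₀) := by
    intro y
    rw [← lintegral_indicator measurableSet_Iic]
    refine lintegral_congr fun x => ?_
    by_cases hx : x ∈ Iic y
    · have : ∫⁻ τ in Ioc x₀ x, (Iic y).indicator u τ = ∫⁻ τ in Ioc x₀ x, u τ :=
        setLIntegral_congr_fun measurableSet_Ioc fun τ hτ =>
          indicator_of_mem (mem_Iic.2 (hτ.2.trans hx)) u
      rw [this, indicator_of_mem hx, indicator_of_mem hx]
    · rw [indicator_of_notMem hx, indicator_of_notMem hx, mul_zero, zero_mul]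
  have hlim := (((ENNReal.continuous_rpow_const (y := (p - r) / (p * r))).tendsto _).comp
    ((aecover_Iic (μ := volume.restrict (Ioi x₀)) (l := Filter.atTop) Filter.tendsto_id
      ).lintegral_tendsto_of_countably_generated hFm.aemeasurable))
  refine le_of_tendsto (ENNReal.Tendsto.const_mul (a := K) hlim (Or.inl ?_))
    (Filter.Eventually.of_forall fun y => ?_)
  · exact (ENNReal.rpow_eq_zero_iff_of_pos he).not.2 h0
  rw [Function.comp_apply, id, ← htrunc y]
  have hle : (Iic y).indicator u ≤ u := indicator_le_self _ _
  refine mul_hardyIntegral_rpow_le_of_lt_top hp hr hrp (hu.indicator measurableSet_Iic) hv hx₀ hvfin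
    (fun s => (lintegral_mono hle).trans_lt (hufin s)) ?_ fun h hh => le_trans ?_ (hK h hh)
  · rw [htrunc, Measure.restrict_restrict measurableSet_Iic, inter_comm, Ioi_inter_Iic]
    calc ∫⁻ x in Ioc x₀ y, F x
        ≤ ∫⁻ x in Ioc x₀ y, (∫⁻ τ in Ioc x₀ y, u τ) ^ (r / (p - r)) *
            (∫⁻ τ in Ioi x₀, dualWeight p v τ) ^ ((p - 1) * r / (p - r)) * u x := by
          refine setLIntegral_mono' measurableSet_Ioc fun x hx => ?_
          have e1 := monotone_setLIntegral_Ioc u x₀ hx.2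
          have e2 := antitone_setLIntegral_Ioi (dualWeight p v) hx.1.le
          refine le_trans (le_of_eq ?_) (mul_le_mul' (mul_le_mul' (ENNReal.rpow_le_rpow e1
            (by positivity : 0 ≤ r / (p - r))) (ENNReal.rpow_le_rpow e2
            (by positivity : 0 ≤ (p - 1) * r / (p - r)))) le_rfl)
          exact mul_right_comm _ _ _
      _ < ∞ := by
          rw [lintegral_const_mul _ hu]
          refine ENNReal.mul_lt_top (ENNReal.mul_lt_top ?_ ?_) (hufin y)
          · exact ENNReal.rpow_lt_top_of_nonneg (by positivity) (hufin y).ne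
          · exact ENNReal.rpow_lt_top_of_nonneg (by positivity) (hvfin x₀ le_rfl).ne
  · gcongr with t
    exact hle t

theorem lintegral_primitive_rpow_le_of_inequality (hp : 1 < p) (hq : 0 < q) (hr : 0 < r)
    (hw : Measurable w) (hu : Measurable u) (hv : IsWeight v) {t : ℝ} (ht : 0 < t)
    (hvfin : ∫⁻ τ in Ioi t, dualWeight p v τ < ∞) {C : ℝ≥0∞}
    (hC : ∀ h : ℝ → ℝ≥0∞, Measurable h →
      (∫⁻ x in Ioi 0, (∫⁻ t in Ioi x, (∫⁻ s in Ioi t, h s) ^ r * u t) ^ (q / r) * w x) ^ (1 / q) ≤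
        C * (∫⁻ t in Ioi 0, h t ^ p * v t) ^ (1 / p)) :
    (∫⁻ s in Ioc 0 t, w s * (∫⁻ τ in Ioc s t, u τ) ^ (q / r)) ^ (1 / q) *
      (∫⁻ τ in Ioi t, dualWeight p v τ) ^ ((p - 1) / p) ≤ C := by
  have hp0 : 0 < p := by linarith
  set V := ∫⁻ τ in Ioi t, dualWeight p v τ with hV
  have hV0 : V ≠ 0 := hv.setLIntegral_Ioi_dualWeight_ne_zero ht.le
  have hσm := measurable_dualWeight (p := p) hv
  have h0 := hC ((Ioi t).indicator (dualWeight p v)) (hσm.indicator measurableSet_Ioi)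
  have hright : ∫⁻ τ in Ioi 0, (Ioi t).indicator (dualWeight p v) τ ^ p * v τ = V := by
    have : ∀ τ, (Ioi t).indicator (dualWeight p v) τ ^ p * v τ
        = (Ioi t).indicator (fun τ => dualWeight p v τ ^ p * v τ) τ := fun τ => by
      by_cases hτ : τ ∈ Ioi t <;> simp [hτ, hp0]
    simp_rw [this]
    rw [setLIntegral_indicator measurableSet_Ioi, inter_eq_left.2 (Ioi_subset_Ioi ht.le)]
    refine lintegral_congr_ae ?_
    filter_upwards [hv.ae_restrict (Ioi_subset_Ioi ht.le)] with τ hτ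
    exact dualWeight_rpow_mul hp hτ
  have hmeas : Measurable fun s => ∫⁻ τ in Ioc s t, u τ :=
    Antitone.measurable fun a b hab => lintegral_mono_set (Ioc_subset_Ioc_left hab)
  have hleft : V ^ q * ∫⁻ s in Ioc 0 t, w s * (∫⁻ τ in Ioc s t, u τ) ^ (q / r) ≤
      ∫⁻ x in Ioi 0, (∫⁻ τ in Ioi x,
        (∫⁻ s in Ioi τ, (Ioi t).indicator (dualWeight p v) s) ^ r * u τ) ^ (q / r) * w x := by
    rw [← lintegral_const_mul _ (by fun_prop)]
    refine le_trans ?_ (lintegral_mono_set (Ioc_subset_Ioi_self (a := t)))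
    refine setLIntegral_mono' measurableSet_Ioc fun x hx => ?_
    have hin : V ^ r * ∫⁻ τ in Ioc x t, u τ ≤ ∫⁻ τ in Ioi x,
        (∫⁻ s in Ioi τ, (Ioi t).indicator (dualWeight p v) s) ^ r * u τ := by
      rw [← lintegral_const_mul _ hu]
      refine le_trans ?_ (lintegral_mono_set (Ioc_subset_Ioi_self (a := t)))
      refine setLIntegral_mono' measurableSet_Ioc fun τ hτ => ?_
      rw [setLIntegral_indicator measurableSet_Ioi, inter_eq_left.2 (Ioi_subset_Ioi hτ.2)]
    calc V ^ q * (w x * (∫⁻ τ in Ioc x t, u τ) ^ (q / r))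
        = (V ^ r * ∫⁻ τ in Ioc x t, u τ) ^ (q / r) * w x := by
          rw [ENNReal.mul_rpow_of_nonneg _ _ (by positivity), ← ENNReal.rpow_mul,
            mul_div_cancel₀ _ hr.ne']
          ring
      _ ≤ _ := by gcongr
  rw [hright] at h0
  replace h0 := (ENNReal.rpow_le_rpow hleft (one_div_nonneg.2 hq.le)).trans h0
  rw [ENNReal.mul_rpow_of_nonneg _ _ (by positivity), ← ENNReal.rpow_mul,
    mul_one_div_cancel hq.ne', ENNReal.rpow_one] at h0
  have hc0 : V ^ (1 / p) ≠ 0 := (ENNReal.rpow_pos (pos_iff_ne_zero.2 hV0) hvfin.ne).ne'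
  have hc1 : V ^ (1 / p) ≠ ∞ := (ENNReal.rpow_lt_top_of_nonneg (by positivity) hvfin.ne).ne
  refine (ENNReal.mul_le_mul_iff_left hc0 hc1).1 (le_trans (le_of_eq ?_) h0)
  rw [mul_assoc, ← ENNReal.rpow_add _ _ hV0 hvfin.ne, mul_comm,
    show (p - 1) / p + 1 / p = 1 by field_simp; ring, ENNReal.rpow_one]

theorem mul_lintegral_rpow_le_of_inequality (hq : 0 < q) (hr : 0 < r) (hw : Measurable w)
    {A : ℝ → ℝ≥0∞} (hA : Antitone A) (t : ℝ) :
    (∫⁻ s in Ioc 0 t, w s) ^ (1 / q) * A t ^ (1 / r) ≤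
      (∫⁻ x in Ioi 0, A x ^ (q / r) * w x) ^ (1 / q) := by
  have h : A t ^ (q / r) * ∫⁻ s in Ioc 0 t, w s ≤ ∫⁻ x in Ioi 0, A x ^ (q / r) * w x := by
    rw [← lintegral_const_mul _ hw]
    refine le_trans ?_ (lintegral_mono_set (Ioc_subset_Ioi_self (a := t)))
    refine setLIntegral_mono' measurableSet_Ioc fun x hx => ?_
    have := hA hx.2
    gcongr
  refine le_trans (le_of_eq ?_) (ENNReal.rpow_le_rpow h (one_div_nonneg.2 hq.le))
  rw [ENNReal.mul_rpow_of_nonneg _ _ (by positivity), ← ENNReal.rpow_mul, mul_comm]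
  congr 2
  field_simp

end NecessityGeneral

section GeometricHardy

theorem ENNReal.exists_tsum_geometric_hardy {s : ℝ} (hs : 1 < s) :
    ∃ D : ℝ≥0∞, D < ∞ ∧ ∀ a : ℤ → ℝ≥0∞,
      ∑' k : ℤ, 2 ^ k * (∑' i : ℕ, a (k + i)) ^ s ≤ D * ∑' k : ℤ, 2 ^ k * a k ^ s := by
  have hs0 : 0 < s := by linarith
  have hs1 : 0 < s - 1 := by linarith
  have hc : s.HolderConjugate (s / (s - 1)) := Real.HolderConjugate.conjExponent hs
  have hs' : 0 < s / (s - 1) := by positivity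
  set c : ℝ≥0∞ := 2 ^ (1 / (2 * s)) with hcdef
  have hc1 : 1 < c := ENNReal.one_lt_rpow (by norm_num) (by positivity)
  have hc0 : c ≠ 0 := (zero_lt_one.trans hc1).ne'
  have hctop : c ≠ ∞ := (ENNReal.rpow_lt_top_of_nonneg (by positivity) (by norm_num)).ne
  have hcs : c ^ s = 2 ^ (1 / 2 : ℝ) := by
    rw [hcdef, ← ENNReal.rpow_mul]
    congr 1
    field_simp
  have hgeom : ∀ θ : ℝ≥0∞, θ < 1 → ∑' i : ℕ, θ ^ i < ∞ := fun θ hθ => by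
    rw [ENNReal.tsum_geometric]
    exact ENNReal.inv_lt_top.2 (tsub_pos_of_lt hθ)
  have hθ₁ : c⁻¹ ^ (s / (s - 1)) < 1 := ENNReal.rpow_lt_one (ENNReal.inv_lt_one.2 hc1) hs'
  have hθ₂ : c ^ s * 2⁻¹ < 1 := by
    rw [hcs, ← ENNReal.rpow_neg_one, ← ENNReal.rpow_add _ _ (by norm_num) (by norm_num)]
    exact ENNReal.rpow_lt_one_of_one_lt_of_neg (by norm_num) (by norm_num)
  set G₁ := ∑' i : ℕ, (c⁻¹ ^ (s / (s - 1))) ^ i with hG₁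
  set G₂ := ∑' i : ℕ, (c ^ s * 2⁻¹) ^ i with hG₂
  refine ⟨(G₁ ^ (1 / (s / (s - 1)))) ^ s * G₂, ENNReal.mul_lt_top
    (ENNReal.rpow_lt_top_of_nonneg hs0.le
      (ENNReal.rpow_lt_top_of_nonneg (by positivity) (hgeom _ hθ₁).ne).ne) (hgeom _ hθ₂),
    fun a => ?_⟩
  have hpow : ∀ (x : ℝ≥0∞) (e : ℝ) (i : ℕ), (x ^ i) ^ e = (x ^ e) ^ i := fun x e i => by
    rw [← ENNReal.rpow_natCast, ← ENNReal.rpow_natCast, ← ENNReal.rpow_mul, ← ENNReal.rpow_mul,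
      mul_comm]
  have hholder : ∀ k : ℤ, (∑' i : ℕ, a (k + i)) ^ s ≤
      (G₁ ^ (1 / (s / (s - 1)))) ^ s * ∑' i : ℕ, (c ^ s) ^ i * a (k + i) ^ s := by
    intro k
    have h1 := ENNReal.inner_le_Lp_mul_Lq_tsum hc (fun i : ℕ => c ^ i * a (k + i))
      (fun i => c⁻¹ ^ i)
    have h2 : ∑' i : ℕ, c ^ i * a (k + i) * c⁻¹ ^ i = ∑' i : ℕ, a (k + i) := by
      refine tsum_congr fun i => ?_
      rw [mul_right_comm, ← mul_pow, ENNReal.mul_inv_cancel hc0 hctop, one_pow, one_mul]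
    rw [h2] at h1
    refine (ENNReal.rpow_le_rpow h1 hs0.le).trans (le_of_eq ?_)
    rw [ENNReal.mul_rpow_of_nonneg _ _ hs0.le, ← ENNReal.rpow_mul, one_div_mul_cancel hs0.ne',
      ENNReal.rpow_one, mul_comm]
    simp_rw [ENNReal.mul_rpow_of_nonneg _ _ hs0.le, hpow]
    rfl
  have hshift : ∀ i : ℕ, ∑' k : ℤ, 2 ^ k * a (k + i) ^ s =
      2⁻¹ ^ i * ∑' k : ℤ, 2 ^ k * a k ^ s := by
    intro i
    rw [← ENNReal.tsum_mul_left, ← (Equiv.addRight (i : ℤ)).tsum_eq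
      (fun k : ℤ => 2⁻¹ ^ i * (2 ^ k * a k ^ s))]
    refine tsum_congr fun k => ?_
    rw [Equiv.coe_addRight, ENNReal.zpow_add (by norm_num) (by norm_num), zpow_natCast,
      ← mul_assoc, mul_left_comm (2⁻¹ ^ i), ← mul_pow,
      ENNReal.inv_mul_cancel (by norm_num) (by norm_num), one_pow, mul_one]
  calc ∑' k : ℤ, 2 ^ k * (∑' i : ℕ, a (k + i)) ^ s
      ≤ ∑' k : ℤ, (G₁ ^ (1 / (s / (s - 1)))) ^ s *
          ∑' i : ℕ, (c ^ s) ^ i * (2 ^ k * a (k + i) ^ s) := by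
        refine ENNReal.tsum_le_tsum fun k => ?_
        refine (mul_le_mul_right (hholder k) _).trans (le_of_eq ?_)
        rw [mul_left_comm, ← ENNReal.tsum_mul_left]
        simp_rw [mul_left_comm]
    _ = (G₁ ^ (1 / (s / (s - 1)))) ^ s *
          ∑' i : ℕ, (c ^ s) ^ i * (2⁻¹ ^ i * ∑' k : ℤ, 2 ^ k * a k ^ s) := by
        rw [ENNReal.tsum_mul_left, ENNReal.tsum_comm]
        simp_rw [ENNReal.tsum_mul_left, hshift]
    _ = _ := by
        simp_rw [← mul_assoc, ← mul_pow]
        rw [ENNReal.tsum_mul_right, ← mul_assoc]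

theorem ENNReal.add_rpow_le_two_rpow_mul {s : ℝ} (hs : 0 ≤ s) (a b : ℝ≥0∞) :
    (a + b) ^ s ≤ 2 ^ s * (a ^ s + b ^ s) := by
  have h : a + b ≤ 2 * max a b := by
    rw [two_mul]
    exact add_le_add (le_max_left _ _) (le_max_right _ _)
  refine (ENNReal.rpow_le_rpow h hs).trans ?_
  rw [ENNReal.mul_rpow_of_nonneg _ _ hs]
  gcongr
  rcases le_total a b with hab | hab
  · rw [max_eq_right hab]
    exact le_add_self
  · rw [max_eq_left hab]
    exact le_self_add

end GeometricHardy

section PrimitiveLevels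

variable {p q r : ℝ} {u v w h : ℝ → ℝ≥0∞}

/-- The dyadic level sets of the primitive of `w`. -/
def primitiveLevel (w : ℝ → ℝ≥0∞) (k : ℤ) : Set ℝ :=
  {x | 0 < x ∧ 2 ^ k < ∫⁻ s in Ioc 0 x, w s ∧ ∫⁻ s in Ioc 0 x, w s ≤ 2 ^ (k + 1)}

/-- The primitive of `w` reaches the value `2 ^ k`. -/
def PrimitiveReaches (w : ℝ → ℝ≥0∞) (k : ℤ) : Prop :=
  ∃ x, 0 < x ∧ 2 ^ k ≤ ∫⁻ s in Ioc 0 x, w s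

theorem measurableSet_primitiveLevel (w : ℝ → ℝ≥0∞) (k : ℤ) :
    MeasurableSet (primitiveLevel w k) := by
  have hm := (monotone_setLIntegral_Ioc w 0).measurable
  exact measurableSet_Ioi.inter
    ((measurableSet_lt measurable_const hm).inter (measurableSet_le hm measurable_const))

theorem primitiveLevel_subset (w : ℝ → ℝ≥0∞) (k : ℤ) : primitiveLevel w k ⊆ Ioi 0 :=
  fun _ hx => hx.1

open scoped Function in
theorem disjoint_primitiveLevel (w : ℝ → ℝ≥0∞) : Pairwise (Disjoint on primitiveLevel w) := by
  refine (pairwise_disjoint_on _).2 fun k l hkl => disjoint_left.2 fun t hk hl => ?_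
  have h1 : (2 : ℝ≥0∞) ^ (k + 1) ≤ 2 ^ l := ENNReal.zpow_le_of_le (by norm_num) hkl
  exact absurd (hk.2.2.trans h1) (not_le.2 hl.2.1)

theorem tsum_setLIntegral_primitiveLevel_le (μ : Measure ℝ) (f : ℝ → ℝ≥0∞) :
    ∑' k, ∫⁻ x in primitiveLevel w k, f x ∂μ ≤ ∫⁻ x, f x ∂μ := by
  rw [← lintegral_iUnion (measurableSet_primitiveLevel w) (disjoint_primitiveLevel w)]
  exact setLIntegral_le_lintegral _ _

theorem PrimitiveReaches.mono {k l : ℤ} (hl : PrimitiveReaches w l) (hkl : k ≤ l) :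
    PrimitiveReaches w k :=
  let ⟨x, hx, hx'⟩ := hl
  ⟨x, hx, (ENNReal.zpow_le_of_le (by norm_num) hkl).trans hx'⟩

theorem PrimitiveReaches.of_mem {k : ℤ} {x : ℝ} (hx : x ∈ primitiveLevel w k) :
    PrimitiveReaches w k :=
  ⟨x, hx.1, hx.2.1.le⟩

theorem exists_mem_primitiveLevel (hw : IsWeight w)
    (hwfin : ∀ x, 0 < x → ∫⁻ s in Ioc 0 x, w s < ∞) {x : ℝ} (hx : 0 < x) :
    ∃ k, x ∈ primitiveLevel w k := by
  obtain ⟨k, hk⟩ := ENNReal.exists_mem_Ioc_zpow (hw.setLIntegral_Ioc_ne_zero le_rfl hx)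
    (hwfin x hx).ne (by norm_num : (1 : ℝ≥0∞) < 2) (by norm_num)
  exact ⟨k, hx, hk⟩

theorem exists_primitive_eq_two_zpow (hwfin : ∀ x, 0 < x → ∫⁻ s in Ioc 0 x, w s < ∞) :
    ∃ y : ℤ → ℝ, ∀ k, PrimitiveReaches w k →
      0 < y k ∧ ∫⁻ s in Ioc 0 (y k), w s = 2 ^ k := by
  have hex : ∀ k, ∃ y, PrimitiveReaches w k → 0 < y ∧ ∫⁻ s in Ioc 0 y, w s = 2 ^ k := by
    intro k
    by_cases hk : PrimitiveReaches w k
    · obtain ⟨x, hx, hxk⟩ := hk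
      obtain ⟨y, hy, -, hyk⟩ := exists_setLIntegral_Ioc_eq (hwfin x hx)
        (ENNReal.zpow_pos (by norm_num) (by norm_num) k) hxk
      exact ⟨y, fun _ => ⟨hy, hyk⟩⟩
    · exact ⟨0, fun h => absurd h hk⟩
  choose y hy using hex
  exact ⟨y, hy⟩

theorem setLIntegral_Ioc_add {a b c : ℝ} (hab : a ≤ b) (hbc : b ≤ c) :
    (∫⁻ s in Ioc a b, w s) + ∫⁻ s in Ioc b c, w s = ∫⁻ s in Ioc a c, w s := by
  rw [← lintegral_union measurableSet_Ioc (Ioc_disjoint_Ioc_of_le le_rfl),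
    Ioc_union_Ioc_eq_Ioc hab hbc]

theorem IsWeight.primitive_lt (hw : IsWeight w) {a b : ℝ} (ha : 0 ≤ a) (hab : a < b)
    (hb : ∫⁻ s in Ioc 0 b, w s < ∞) : ∫⁻ s in Ioc 0 a, w s < ∫⁻ s in Ioc 0 b, w s := by
  rw [← setLIntegral_Ioc_add ha hab.le]
  refine ENNReal.lt_add_right ?_ (hw.setLIntegral_Ioc_ne_zero ha hab)
  exact ((lintegral_mono_set (Ioc_subset_Ioc_right hab.le)).trans_lt hb).ne

variable {y : ℤ → ℝ}

theorem lt_of_mem_primitiveLevel {k : ℤ} {b x : ℝ} (hb : ∫⁻ s in Ioc 0 b, w s = 2 ^ k)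
    (hx : x ∈ primitiveLevel w k) : b < x := by
  by_contra! hcon
  have h : ∫⁻ s in Ioc 0 x, w s ≤ ∫⁻ s in Ioc 0 b, w s := monotone_setLIntegral_Ioc w 0 hcon
  exact absurd (h.trans hb.le) (not_le.2 hx.2.1)

theorem le_of_mem_primitiveLevel (hw : IsWeight w)
    (hwfin : ∀ x, 0 < x → ∫⁻ s in Ioc 0 x, w s < ∞) {k : ℤ} {b x : ℝ} (hb0 : 0 < b)
    (hb : ∫⁻ s in Ioc 0 b, w s = 2 ^ (k + 1)) (hx : x ∈ primitiveLevel w k) : x ≤ b := by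
  by_contra! hcon
  exact absurd (hw.primitive_lt hb0.le hcon (hwfin x hx.1)) (not_lt.2 (hb ▸ hx.2.2))

theorem setLIntegral_primitiveLevel_le (hw : IsWeight w)
    (hwfin : ∀ x, 0 < x → ∫⁻ s in Ioc 0 x, w s < ∞)
    (hy : ∀ k, PrimitiveReaches w k → 0 < y k ∧ ∫⁻ s in Ioc 0 (y k), w s = 2 ^ k) (k : ℤ) :
    ∫⁻ x in primitiveLevel w k, w x ≤ 2 ^ (k + 1) := by
  by_cases hk : PrimitiveReaches w (k + 1)
  · obtain ⟨h0, h1⟩ := hy _ hk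
    rw [← h1]
    exact lintegral_mono_set fun x hx => ⟨hx.1, le_of_mem_primitiveLevel hw hwfin h0 h1 hx⟩
  · refine (lintegral_mono_set (primitiveLevel_subset w k)).trans ?_
    refine le_of_tendsto ((aecover_Iic (μ := volume.restrict (Ioi (0 : ℝ))) (l := Filter.atTop)
      Filter.tendsto_id).lintegral_tendsto_of_countably_generated hw.1.aemeasurable)
      (Filter.Eventually.of_forall fun x => ?_)
    rw [Measure.restrict_restrict measurableSet_Iic, inter_comm, Ioi_inter_Iic, id]
    rcases le_or_gt x 0 with hx | hx
    · simp [Ioc_eq_empty_of_le hx]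
    · by_contra! hcon
      exact hk ⟨x, hx, hcon.le⟩

theorem setLIntegral_primitiveLevel_pred_ge (hw : IsWeight w)
    (hwfin : ∀ x, 0 < x → ∫⁻ s in Ioc 0 x, w s < ∞)
    (hy : ∀ k, PrimitiveReaches w k → 0 < y k ∧ ∫⁻ s in Ioc 0 (y k), w s = 2 ^ k) {k : ℤ}
    (hk : PrimitiveReaches w k) :
    2 ^ (k - 1) ≤ ∫⁻ x in primitiveLevel w (k - 1), w x := by
  obtain ⟨h0, h1⟩ := hy _ hk
  obtain ⟨h2, h3⟩ := hy _ (hk.mono (sub_le_self k zero_le_one))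
  have hle : y (k - 1) ≤ y k := by
    by_contra! hcon
    have := monotone_setLIntegral_Ioc w 0 hcon.le
    simp only at this
    rw [h1, h3] at this
    exact absurd this (not_le.2 (ENNReal.two_zpow_lt (sub_one_lt k)))
  have hsub : Ioc (y (k - 1)) (y k) ⊆ primitiveLevel w (k - 1) := fun x hx => by
    refine ⟨h2.trans hx.1, ?_, ?_⟩
    · rw [← h3]
      exact hw.primitive_lt h2.le hx.1 (hwfin x (h2.trans hx.1))
    · rw [sub_add_cancel, ← h1]
      exact monotone_setLIntegral_Ioc w 0 hx.2
  refine le_trans (le_of_eq ?_) (lintegral_mono_set hsub)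
  have hadd := setLIntegral_Ioc_add (w := w) h2.le hle
  rw [h1, h3, ← sub_add_cancel k 1, ENNReal.two_zpow_succ, two_mul, add_sub_cancel_right] at hadd
  have hne : (2 : ℝ≥0∞) ^ (k - 1) ≠ ∞ :=
    (ENNReal.zpow_lt_top (by norm_num) (by norm_num) _).ne
  rw [sub_add_cancel] at hadd
  exact ((ENNReal.add_right_inj hne).1 hadd).symm

end PrimitiveLevels

section Sufficiency

variable {p q r : ℝ} {u v w h : ℝ → ℝ≥0∞} {y : ℤ → ℝ} {E : ℝ≥0∞}

theorem two_zpow_mul_local_le (hp : 1 < p) (hq : 0 < q) (hr : 0 < r) (hrp : r < p)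
    (hu : Measurable u) (hv : IsWeight v) (hh : Measurable h)
    (hfin : ∀ t, 0 < t → ∫⁻ τ in Ioi t, h τ < ∞)
    (hufin : ∀ s t, 0 < s → ∫⁻ τ in Ioc s t, u τ < ∞)
    (hy : ∀ k, PrimitiveReaches w k → 0 < y k ∧ ∫⁻ s in Ioc 0 (y k), w s = 2 ^ k)
    (hE : ∀ t, 0 < t → (∫⁻ s in Ioc 0 t, w s) ^ (1 / q) *
      hardyIntegral p r u v t ^ ((p - r) / (p * r)) ≤ E) (k : ℤ) :
    2 ^ k * (∫⁻ t in primitiveLevel w k,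
        (∫⁻ τ in Ioi t, (primitiveLevel w k).indicator h τ) ^ r * u t) ^ (q / r) ≤
      4 ^ q * ENNReal.ofReal (p / (p - r)) ^ ((p - r) / p * (q / r)) * E ^ q *
        (∫⁻ t in primitiveLevel w k, h t ^ p * v t) ^ (q / p) := by
  have hp0 : 0 < p := by linarith
  have hpr : 0 < p - r := by linarith
  have hqr : 0 < q / r := by positivity
  have hI := measurableSet_primitiveLevel w k
  by_cases hk : PrimitiveReaches w k
  swap
  · have : primitiveLevel w k = ∅ :=
      eq_empty_of_forall_notMem fun x hx => hk (PrimitiveReaches.of_mem hx)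
    simp [this, hqr]
  obtain ⟨hy0, hyk⟩ := hy k hk
  have hsub : primitiveLevel w k ⊆ Ioi (y k) := fun x hx => lt_of_mem_primitiveLevel hyk hx
  have hle : (primitiveLevel w k).indicator h ≤ h := indicator_le_self _ _
  have h1 := lintegral_tail_rpow_mul_le hp hr hrp hu hv (hh.indicator hI)
    (fun t ht => (lintegral_mono hle).trans_lt (hfin t ht)) hy0 (fun s => hufin (y k) s hy0)
  have hN : ∫⁻ t in Ioi 0, (primitiveLevel w k).indicator h t ^ p * v t =
      ∫⁻ t in primitiveLevel w k, h t ^ p * v t := by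
    have : ∀ t, (primitiveLevel w k).indicator h t ^ p * v t
        = (primitiveLevel w k).indicator (fun t => h t ^ p * v t) t := fun t => by
      by_cases ht : t ∈ primitiveLevel w k <;> simp [ht, hp0]
    simp_rw [this]
    rw [setLIntegral_indicator hI, inter_eq_left.2 (primitiveLevel_subset w k)]
  rw [hN] at h1
  have h2 := ENNReal.rpow_le_rpow ((lintegral_mono_set hsub).trans h1) hqr.le
  have h3 := ENNReal.rpow_le_rpow (hE (y k) hy0) hq.le
  rw [hyk, ENNReal.mul_rpow_of_nonneg _ _ hq.le, ← ENNReal.rpow_mul, one_div_mul_cancel hq.ne',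
    ENNReal.rpow_one, ← ENNReal.rpow_mul] at h3
  refine (mul_le_mul_right h2 _).trans ?_
  rw [ENNReal.mul_rpow_of_nonneg _ _ hqr.le, ENNReal.mul_rpow_of_nonneg _ _ hqr.le,
    ENNReal.mul_rpow_of_nonneg _ _ (by positivity : 0 ≤ (p - r) / p),
    ENNReal.mul_rpow_of_nonneg _ _ hqr.le, ← ENNReal.rpow_mul, ← ENNReal.rpow_mul,
    ← ENNReal.rpow_mul, ← ENNReal.rpow_mul, mul_div_cancel₀ _ hr.ne',
    show r / p * (q / r) = q / p by field_simp]
  rw [show (p - r) / (p * r) * q = (p - r) / p * (q / r) by field_simp] at h3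
  calc _ = 4 ^ q * ENNReal.ofReal (p / (p - r)) ^ ((p - r) / p * (q / r)) *
        (2 ^ k * hardyIntegral p r u v (y k) ^ ((p - r) / p * (q / r))) *
        (∫⁻ t in primitiveLevel w k, h t ^ p * v t) ^ (q / p) := by ring
    _ ≤ _ := by gcongr

theorem tsum_setLIntegral_rpow_le (hqr : 0 < q / r) (hw : IsWeight w)
    (hwfin : ∀ x, 0 < x → ∫⁻ s in Ioc 0 x, w s < ∞)
    (hy : ∀ k, PrimitiveReaches w k → 0 < y k ∧ ∫⁻ s in Ioc 0 (y k), w s = 2 ^ k) {c : ℤ → ℝ≥0∞}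
    (hc : ∀ k, c k ≤ 2 ^ k * (∫⁻ τ in primitiveLevel w k, u τ) ^ (q / r))
    (hc0 : ∀ k, ¬ PrimitiveReaches w (k + 1) → c k = 0) (t : ℝ) :
    ∑' k, c k * (Ioc 0 t).indicator 1 (y (k + 1)) ≤
      2 * ∫⁻ s in Ioc 0 t, w s * (∫⁻ τ in Ioc s t, u τ) ^ (q / r) := by
  set F : ℝ → ℝ≥0∞ := fun s => w s * (∫⁻ τ in Ioc s t, u τ) ^ (q / r) with hF
  calc ∑' k, c k * (Ioc 0 t).indicator 1 (y (k + 1))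
      ≤ ∑' k, 2 * ∫⁻ s in primitiveLevel w (k - 1), F s ∂volume.restrict (Ioc 0 t) := by
        refine ENNReal.tsum_le_tsum fun k => ?_
        by_cases hk : PrimitiveReaches w (k + 1)
        swap
        · rw [hc0 k hk, zero_mul]
          exact zero_le
        by_cases hkt : y (k + 1) ∈ Ioc 0 t
        swap
        · rw [indicator_of_notMem hkt, mul_zero]
          exact zero_le
        have hk' : PrimitiveReaches w k := hk.mono (by lia)
        obtain ⟨h0, h1⟩ := hy _ hk
        obtain ⟨h2, h3⟩ := hy _ hk'
        have hyle : y k ≤ t := by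
          by_contra! hcon
          have h4 : ∫⁻ s in Ioc 0 (y (k + 1)), w s ≤ ∫⁻ s in Ioc 0 (y k), w s :=
            monotone_setLIntegral_Ioc w 0 (hkt.2.trans hcon.le)
          rw [h1, h3] at h4
          exact absurd h4 (not_le.2 (ENNReal.two_zpow_lt (lt_add_one k)))
        have hpred : ∀ x ∈ primitiveLevel w (k - 1), x ≤ y k := fun x hx =>
          le_of_mem_primitiveLevel hw hwfin h2 (by rw [h3, sub_add_cancel]) hx
        have hsub : primitiveLevel w (k - 1) ⊆ Ioc 0 t := fun x hx =>
          ⟨hx.1, (hpred x hx).trans hyle⟩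
        rw [indicator_of_mem hkt, Pi.one_apply, mul_one,
          Measure.restrict_restrict (measurableSet_primitiveLevel w _), inter_eq_left.2 hsub]
        refine (hc k).trans ?_
        calc 2 ^ k * (∫⁻ τ in primitiveLevel w k, u τ) ^ (q / r)
            = 2 * (2 ^ (k - 1) * (∫⁻ τ in primitiveLevel w k, u τ) ^ (q / r)) := by
              rw [← mul_assoc, ← ENNReal.two_zpow_succ, sub_add_cancel]
          _ ≤ 2 * ((∫⁻ x in primitiveLevel w (k - 1), w x) *
                (∫⁻ τ in primitiveLevel w k, u τ) ^ (q / r)) := by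
              gcongr
              exact setLIntegral_primitiveLevel_pred_ge hw hwfin hy hk'
          _ ≤ _ := by
              rw [← lintegral_mul_const _ hw.1]
              refine mul_le_mul_right ?_ 2
              refine setLIntegral_mono' (measurableSet_primitiveLevel w _) fun x hx => ?_
              refine mul_le_mul_right (ENNReal.rpow_le_rpow (lintegral_mono_set fun z hz => ?_)
                hqr.le) (w x)
              exact ⟨(hpred x hx).trans_lt (lt_of_mem_primitiveLevel h3 hz),
                (le_of_mem_primitiveLevel hw hwfin h0 h1 hz).trans hkt.2⟩
    _ = 2 * ∑' k, ∫⁻ s in primitiveLevel w k, F s ∂volume.restrict (Ioc 0 t) := by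
        rw [ENNReal.tsum_mul_left, ← (Equiv.subRight (1 : ℤ)).tsum_eq
          (fun k => ∫⁻ s in primitiveLevel w k, F s ∂volume.restrict (Ioc 0 t))]
        rfl
    _ ≤ _ := by
        gcongr
        exact tsum_setLIntegral_primitiveLevel_le _ _

theorem tsum_mul_tail_rpow_le (hp : 1 < p) (hpq : p ≤ q) (hr : 0 < r) (hw : IsWeight w)
    (hv : IsWeight v) (hh : Measurable h) (hfin : ∀ t, 0 < t → ∫⁻ τ in Ioi t, h τ < ∞)
    (hwfin : ∀ x, 0 < x → ∫⁻ s in Ioc 0 x, w s < ∞)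
    (hy : ∀ k, PrimitiveReaches w k → 0 < y k ∧ ∫⁻ s in Ioc 0 (y k), w s = 2 ^ k)
    (hE : ∀ t, 0 < t → (∫⁻ s in Ioc 0 t, w s * (∫⁻ τ in Ioc s t, u τ) ^ (q / r)) ^ (1 / q) *
      (∫⁻ τ in Ioi t, dualWeight p v τ) ^ ((p - 1) / p) ≤ E) {c : ℤ → ℝ≥0∞}
    (hc : ∀ k, c k ≤ 2 ^ k * (∫⁻ τ in primitiveLevel w k, u τ) ^ (q / r))
    (hc0 : ∀ k, ¬ PrimitiveReaches w (k + 1) → c k = 0) :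
    ∑' k, c k * (∫⁻ τ in Ioi (y (k + 1)), h τ) ^ q ≤
      4 ^ q * (2 * E ^ q) * (∫⁻ t in Ioi 0, h t ^ p * v t) ^ (q / p) := by
  have hp0 : 0 < p := by linarith
  have hq : 0 < q := by linarith
  set μ : Measure ℝ := Measure.sum fun k => c k • Measure.dirac (y (k + 1)) with hμ
  have hHm := (antitone_setLIntegral_Ioi h).measurable
  have hint : ∑' k, c k * (∫⁻ τ in Ioi (y (k + 1)), h τ) ^ q =
      ∫⁻ t in Ioi 0, (∫⁻ τ in Ioi t, h τ) ^ q ∂μ := by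
    rw [← lintegral_indicator measurableSet_Ioi, hμ, lintegral_sum_measure]
    refine tsum_congr fun k => ?_
    rw [lintegral_smul_measure,
      lintegral_dirac' _ ((hHm.pow_const q).indicator measurableSet_Ioi), smul_eq_mul]
    by_cases hk : PrimitiveReaches w (k + 1)
    · rw [indicator_of_mem (mem_Ioi.2 (hy _ hk).1)]
    · rw [hc0 k hk, zero_mul, zero_mul]
  rw [hint]
  refine lintegral_tail_rpow_le_of_le hp hpq hv hh hfin μ fun t ht => ?_
  have hμt : μ (Ioc 0 t) = ∑' k, c k * (Ioc 0 t).indicator 1 (y (k + 1)) := by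
    rw [hμ, Measure.sum_apply _ measurableSet_Ioc]
    refine tsum_congr fun k => ?_
    rw [Measure.smul_apply, Measure.dirac_apply' _ measurableSet_Ioc, smul_eq_mul]
  rw [hμt]
  refine (mul_le_mul_left (tsum_setLIntegral_rpow_le (by positivity) hw hwfin hy hc hc0 t) _).trans
    ?_
  have h1 := ENNReal.rpow_le_rpow (hE t ht) hq.le
  rw [ENNReal.mul_rpow_of_nonneg _ _ hq.le, ← ENNReal.rpow_mul, one_div_mul_cancel hq.ne',
    ENNReal.rpow_one, ← ENNReal.rpow_mul] at h1
  rw [mul_assoc]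
  gcongr

theorem lintegral_iterated_le_tsum (hr : 0 < r) (hq : 0 < q) (hw : IsWeight w)
    (hwfin : ∀ x, 0 < x → ∫⁻ s in Ioc 0 x, w s < ∞)
    (hy : ∀ k, PrimitiveReaches w k → 0 < y k ∧ ∫⁻ s in Ioc 0 (y k), w s = 2 ^ k)
    (g : ℝ → ℝ≥0∞) :
    ∫⁻ x in Ioi 0, (∫⁻ t in Ioi x, g t) ^ (q / r) * w x ≤
      2 * ∑' k : ℤ, 2 ^ k * (∑' i : ℕ, ∫⁻ t in primitiveLevel w (k + i), g t) ^ (q / r) := by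
  have hqr : 0 < q / r := by positivity
  have hcov : Ioi 0 ⊆ ⋃ k, primitiveLevel w k := fun x hx =>
    mem_iUnion.2 (exists_mem_primitiveLevel hw hwfin hx)
  refine (lintegral_mono_set hcov).trans ((lintegral_iUnion_le _ _).trans ?_)
  rw [← ENNReal.tsum_mul_left]
  refine ENNReal.tsum_le_tsum fun k => ?_
  calc ∫⁻ x in primitiveLevel w k, (∫⁻ t in Ioi x, g t) ^ (q / r) * w x
      ≤ ∫⁻ x in primitiveLevel w k,
          (∑' i : ℕ, ∫⁻ t in primitiveLevel w (k + i), g t) ^ (q / r) * w x := by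
        refine setLIntegral_mono' (measurableSet_primitiveLevel w k) fun x hx => ?_
        gcongr
        refine (lintegral_mono_set fun z hz => ?_).trans (lintegral_iUnion_le _ _)
        obtain ⟨j, hj⟩ := exists_mem_primitiveLevel hw hwfin (lt_trans hx.1 (mem_Ioi.1 hz))
        have hmono : ∫⁻ s in Ioc 0 x, w s ≤ ∫⁻ s in Ioc 0 z, w s :=
          monotone_setLIntegral_Ioc w 0 (le_of_lt (mem_Ioi.1 hz))
        have hkj : k ≤ j := by
          by_contra! hcon
          have h1 := ENNReal.zpow_le_of_le (by norm_num : (1 : ℝ≥0∞) ≤ 2)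
            (Int.add_one_le_of_lt hcon)
          exact absurd ((hx.2.1.trans_le hmono).trans_le (hj.2.2.trans h1)) (lt_irrefl _)
        obtain ⟨i, rfl⟩ := Int.le.dest hkj
        exact mem_iUnion.2 ⟨i, hj⟩
    _ ≤ 2 * (2 ^ k * (∑' i : ℕ, ∫⁻ t in primitiveLevel w (k + i), g t) ^ (q / r)) := by
        rw [lintegral_const_mul _ hw.1, mul_comm, ← mul_assoc, ← ENNReal.two_zpow_succ]
        gcongr
        exact setLIntegral_primitiveLevel_le hw hwfin hy k

theorem setLIntegral_primitiveLevel_tail_rpow_le (hr : 0 < r) (hu : Measurable u) {k : ℤ} {b : ℝ} {T : ℝ≥0∞}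
    (hT : PrimitiveReaches w (k + 1) → ∫⁻ τ in Ioi b, h τ ≤ T)
    (hb : PrimitiveReaches w (k + 1) → ∫⁻ s in Ioc 0 b, w s = 2 ^ (k + 1)) :
    ∫⁻ t in primitiveLevel w k, (∫⁻ τ in Ioi t, h τ) ^ r * u t ≤
      2 ^ r * ((∫⁻ t in primitiveLevel w k,
          (∫⁻ τ in Ioi t, (primitiveLevel w k).indicator h τ) ^ r * u t) +
        T ^ r * ∫⁻ t in primitiveLevel w k, u t) := by
  have hI := measurableSet_primitiveLevel w k
  have hm := (antitone_setLIntegral_Ioi ((primitiveLevel w k).indicator h)).measurable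
  rw [← lintegral_const_mul _ hu, ← lintegral_add_left (by fun_prop),
    ← lintegral_const_mul _ (by fun_prop)]
  refine setLIntegral_mono' hI fun t ht => ?_
  have hmem : ∀ z, t < z → ∫⁻ s in Ioc 0 z, w s ≤ 2 ^ (k + 1) → z ∈ primitiveLevel w k :=
    fun z hz hz' => ⟨ht.1.trans hz, ht.2.1.trans_le (monotone_setLIntegral_Ioc w 0 hz.le), hz'⟩
  have htail : ∫⁻ τ in Ioi t, h τ ≤
      (∫⁻ τ in Ioi t, (primitiveLevel w k).indicator h τ) + T := by
    rw [setLIntegral_indicator hI]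
    by_cases hk : PrimitiveReaches w (k + 1)
    · have hsub : Ioi t ⊆ primitiveLevel w k ∩ Ioi t ∪ Ioi b := fun z hz => by
        rcases le_or_gt z b with hzb | hzb
        · exact Or.inl ⟨hmem z hz ((monotone_setLIntegral_Ioc w 0 hzb).trans_eq (hb hk)), hz⟩
        · exact Or.inr hzb
      exact (lintegral_mono_set hsub).trans ((lintegral_union_le _ _ _).trans
        (add_le_add_right (hT hk) _))
    · refine (lintegral_mono_set fun z hz => ?_).trans le_self_add
      refine ⟨hmem z hz ?_, hz⟩
      by_contra! hcon
      exact hk ⟨z, ht.1.trans hz, hcon.le⟩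
  calc (∫⁻ τ in Ioi t, h τ) ^ r * u t
      ≤ 2 ^ r * ((∫⁻ τ in Ioi t, (primitiveLevel w k).indicator h τ) ^ r + T ^ r) * u t := by
        gcongr
        exact (ENNReal.rpow_le_rpow htail hr.le).trans (ENNReal.add_rpow_le_two_rpow_mul hr.le _ _)
    _ = _ := by ring

theorem exists_lintegral_iterated_rpow_le (hp : 1 < p) (hr : 0 < r) (hrp : r < p) (hpq : p ≤ q)
    (hu : Measurable u) (hw : IsWeight w) (hv : IsWeight v)
    (hvfin : ∀ x, 0 < x → ∫⁻ t in Ioi x, dualWeight p v t < ∞)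
    (hufin : ∀ s t, 0 < s → ∫⁻ τ in Ioc s t, u τ < ∞)
    (hwfin : ∀ x, 0 < x → ∫⁻ s in Ioc 0 x, w s < ∞) {E₁ E₄ : ℝ≥0∞}
    (hE₁ : ∀ t, 0 < t → (∫⁻ s in Ioc 0 t, w s * (∫⁻ τ in Ioc s t, u τ) ^ (q / r)) ^ (1 / q) *
      (∫⁻ τ in Ioi t, dualWeight p v τ) ^ ((p - 1) / p) ≤ E₁)
    (hE₄ : ∀ t, 0 < t → (∫⁻ s in Ioc 0 t, w s) ^ (1 / q) *
      hardyIntegral p r u v t ^ ((p - r) / (p * r)) ≤ E₄) (hE₁fin : E₁ < ∞) (hE₄fin : E₄ < ∞) :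
    ∃ D : ℝ≥0∞, D < ∞ ∧ ∀ h : ℝ → ℝ≥0∞, Measurable h → ∫⁻ t in Ioi 0, h t ^ p * v t < ∞ →
      ∫⁻ x in Ioi 0, (∫⁻ t in Ioi x, (∫⁻ s in Ioi t, h s) ^ r * u t) ^ (q / r) * w x ≤
        D * (∫⁻ t in Ioi 0, h t ^ p * v t) ^ (q / p) := by
  classical
  have hp0 : 0 < p := by linarith
  have hq : 0 < q := by linarith
  have hqr1 : 1 < q / r := (one_lt_div hr).2 (by linarith)
  have hqr : 0 < q / r := by linarith
  obtain ⟨y, hy⟩ := exists_primitive_eq_two_zpow hwfin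
  obtain ⟨D, hD, hDle⟩ := ENNReal.exists_tsum_geometric_hardy hqr1
  set K₁ : ℝ≥0∞ := 4 ^ q * ENNReal.ofReal (p / (p - r)) ^ ((p - r) / p * (q / r)) * E₄ ^ q with hK₁
  set K₂ : ℝ≥0∞ := 4 ^ q * (2 * E₁ ^ q) with hK₂
  set M : ℝ≥0∞ := (2 ^ r) ^ (q / r) * 2 ^ (q / r) with hM
  have hfinpow : ∀ (x : ℝ≥0∞) (e : ℝ), 0 ≤ e → x < ∞ → x ^ e < ∞ := fun x e he hx =>
    ENNReal.rpow_lt_top_of_nonneg he hx.ne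
  refine ⟨2 * (D * (M * (K₁ + K₂))), ?_, fun h hh hN => ?_⟩
  · have h1 : M < ∞ := ENNReal.mul_lt_top
      (hfinpow _ _ hqr.le (hfinpow _ _ hr.le (by norm_num))) (hfinpow _ _ hqr.le (by norm_num))
    have h2 : K₁ < ∞ := ENNReal.mul_lt_top (ENNReal.mul_lt_top
      (hfinpow _ _ hq.le (by norm_num)) (hfinpow _ _
        (mul_nonneg (div_nonneg (by linarith) hp0.le) hqr.le) ENNReal.ofReal_lt_top))
      (hfinpow _ _ hq.le hE₄fin)
    have h3 : K₂ < ∞ := ENNReal.mul_lt_top (hfinpow _ _ hq.le (by norm_num))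
      (ENNReal.mul_lt_top (by norm_num) (hfinpow _ _ hq.le hE₁fin))
    exact ENNReal.mul_lt_top (by norm_num) (ENNReal.mul_lt_top hD (ENNReal.mul_lt_top h1
      (ENNReal.add_lt_top.2 ⟨h2, h3⟩)))
  have hfin : ∀ t, 0 < t → ∫⁻ τ in Ioi t, h τ < ∞ := fun t ht =>
    tail_lt_top hp hv hvfin hh hN ht
  set N := ∫⁻ t in Ioi 0, h t ^ p * v t with hNdef
  set I := primitiveLevel w with hI
  set H : ℝ → ℝ≥0∞ := fun t => ∫⁻ τ in Ioi t, h τ with hH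
  set T : ℤ → ℝ≥0∞ := fun k => if PrimitiveReaches w (k + 1) then H (y (k + 1)) else 0 with hT
  set c : ℤ → ℝ≥0∞ := fun k =>
    if PrimitiveReaches w (k + 1) then 2 ^ k * (∫⁻ τ in I k, u τ) ^ (q / r) else 0 with hc
  set b : ℤ → ℝ≥0∞ := fun k => ∫⁻ t in I k, (∫⁻ τ in Ioi t, (I k).indicator h τ) ^ r * u t with hb
  have hlocal : ∀ k : ℤ, 2 ^ k * (∫⁻ t in I k, H t ^ r * u t) ^ (q / r) ≤
      M * (2 ^ k * b k ^ (q / r) + c k * H (y (k + 1)) ^ q) := by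
    intro k
    have h1 : ∫⁻ t in I k, H t ^ r * u t ≤ 2 ^ r * (b k + T k ^ r * ∫⁻ t in I k, u t) :=
      setLIntegral_primitiveLevel_tail_rpow_le hr hu (b := y (k + 1))
        (fun hk => by simp only [hT, if_pos hk]; exact le_rfl) (fun hk => (hy _ hk).2)
    have h2 : 2 ^ k * (T k ^ r * ∫⁻ t in I k, u t) ^ (q / r) = c k * H (y (k + 1)) ^ q := by
      by_cases hk : PrimitiveReaches w (k + 1)
      · simp only [hT, hc, if_pos hk]
        rw [ENNReal.mul_rpow_of_nonneg _ _ hqr.le, ← ENNReal.rpow_mul, mul_div_cancel₀ _ hr.ne']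
        ring
      · simp only [hT, hc, if_neg hk]
        rw [ENNReal.zero_rpow_of_pos hr, zero_mul, ENNReal.zero_rpow_of_pos hqr, mul_zero, zero_mul]
    calc 2 ^ k * (∫⁻ t in I k, H t ^ r * u t) ^ (q / r)
        ≤ 2 ^ k * (2 ^ r * (b k + T k ^ r * ∫⁻ t in I k, u t)) ^ (q / r) := by gcongr
      _ ≤ 2 ^ k * ((2 ^ r) ^ (q / r) * (2 ^ (q / r) *
            (b k ^ (q / r) + (T k ^ r * ∫⁻ t in I k, u t) ^ (q / r)))) := by
          rw [ENNReal.mul_rpow_of_nonneg _ _ hqr.le]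
          gcongr
          exact ENNReal.add_rpow_le_two_rpow_mul hqr.le _ _
      _ = M * (2 ^ k * b k ^ (q / r) + 2 ^ k * (T k ^ r * ∫⁻ t in I k, u t) ^ (q / r)) := by
          rw [hM]; ring
      _ = _ := by rw [h2]
  have hsum₁ : ∑' k : ℤ, 2 ^ k * b k ^ (q / r) ≤ K₁ * N ^ (q / p) := by
    calc ∑' k : ℤ, 2 ^ k * b k ^ (q / r)
        ≤ ∑' k, K₁ * (∫⁻ t in I k, h t ^ p * v t) ^ (q / p) := ENNReal.tsum_le_tsum fun k =>
          two_zpow_mul_local_le hp hq hr hrp hu hv hh hfin hufin hy hE₄ k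
      _ ≤ K₁ * (∑' k, ∫⁻ t in I k, h t ^ p * v t) ^ (q / p) := by
          rw [ENNReal.tsum_mul_left]
          gcongr
          exact ENNReal.tsum_rpow_le_rpow_tsum ((one_le_div hp0).2 hpq) _
      _ ≤ K₁ * N ^ (q / p) := by
          gcongr
          rw [← lintegral_iUnion (measurableSet_primitiveLevel w) (disjoint_primitiveLevel w)]
          exact lintegral_mono_set (iUnion_subset (primitiveLevel_subset w))
  have hsum₂ : ∑' k : ℤ, c k * H (y (k + 1)) ^ q ≤ K₂ * N ^ (q / p) := by
    refine tsum_mul_tail_rpow_le hp hpq hr hw hv hh hfin hwfin hy hE₁ (fun k => ?_) fun k hk => ?_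
    · simp only [hc]
      split_ifs
      · exact le_rfl
      · exact zero_le
    · simp only [hc, if_neg hk]
  calc ∫⁻ x in Ioi 0, (∫⁻ t in Ioi x, H t ^ r * u t) ^ (q / r) * w x
      ≤ 2 * ∑' k : ℤ, 2 ^ k * (∑' i : ℕ, ∫⁻ t in I (k + i), H t ^ r * u t) ^ (q / r) :=
        lintegral_iterated_le_tsum hr hq hw hwfin hy _
    _ ≤ 2 * (D * ∑' k : ℤ, 2 ^ k * (∫⁻ t in I k, H t ^ r * u t) ^ (q / r)) := by
        gcongr
        exact hDle fun k => ∫⁻ t in I k, H t ^ r * u t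
    _ ≤ 2 * (D * (M * (K₁ * N ^ (q / p) + K₂ * N ^ (q / p)))) := by
        gcongr
        refine (ENNReal.tsum_le_tsum hlocal).trans ?_
        rw [ENNReal.tsum_mul_left, ENNReal.tsum_add]
        gcongr
    _ = _ := by ring

end Sufficiency

theorem statement18 (p q r : ℝ) (hq : 0 < q) (hr : 0 < r) (hp : 1 < p) (hrp : r < p) (hpq : p ≤ q)
    (u w v : ℝ → ℝ≥0∞) (hu : IsWeight u) (hw : IsWeight w) (hv : IsWeight v)
    (hvfin : ∀ x ∈ Ioi (0 : ℝ), (∫⁻ t in Ioi x, v t ^ (1 - p / (p - 1))) < ∞) :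
    (∃ C : ℝ≥0, 0 < C ∧ ∀ h : ℝ → ℝ≥0∞, Measurable h →
        (∫⁻ x in Ioi (0 : ℝ),
            (∫⁻ t in Ioi x, (∫⁻ s in Ioi t, h s) ^ r * u t) ^ (q / r) * w x) ^
          (1 / q) ≤
          (C : ℝ≥0∞) * (∫⁻ t in Ioi (0 : ℝ), h t ^ p * v t) ^ (1 / p)) ↔
      ((⨆ t ∈ Ioi (0 : ℝ),
        (∫⁻ s in Ioc (0 : ℝ) t, w s * (∫⁻ τ in Ioc s t, u τ) ^ (q / r)) ^ (1 / q) *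
          (∫⁻ τ in Ioi t, v τ ^ (1 - p / (p - 1))) ^ ((p - 1) / p)) < ∞ ∧
      (⨆ t ∈ Ioi (0 : ℝ),
        (∫⁻ s in Ioc (0 : ℝ) t, w s) ^ (1 / q) *
          (∫⁻ x in Ioi t,
              (∫⁻ τ in Ioc t x, u τ) ^ (r / (p - r)) * u x *
                (∫⁻ τ in Ioi x, v τ ^ (1 - p / (p - 1))) ^ ((p - 1) * r / (p - r))) ^
            ((p - r) / (p * r))) < ∞) := by
  have hp0 : 0 < p := by linarith
  have hp1 : 0 < p - 1 := by linarith
  have hpr : 0 < p - r := by linarith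
  have hqr : 0 < q / r := by positivity
  have hvfin' : ∀ x, 0 < x → ∫⁻ t in Ioi x, dualWeight p v t < ∞ := hvfin
  have hVpos : ∀ t, 0 < t → (∫⁻ τ in Ioi t, dualWeight p v τ) ^ ((p - 1) / p) ≠ 0 := fun t ht =>
    (ENNReal.rpow_pos (pos_iff_ne_zero.2 (hv.setLIntegral_Ioi_dualWeight_ne_zero ht.le))
      (hvfin' t ht).ne).ne'
  have hufin : ∀ E : ℝ≥0∞, E < ∞ → (∀ t, 0 < t →
      (∫⁻ s in Ioc 0 t, w s * (∫⁻ τ in Ioc s t, u τ) ^ (q / r)) ^ (1 / q) *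
        (∫⁻ τ in Ioi t, dualWeight p v τ) ^ ((p - 1) / p) ≤ E) →
      ∀ s t, 0 < s → ∫⁻ τ in Ioc s t, u τ < ∞ := by
    intro E hEfin hE s t hs
    rcases le_or_gt t s with hts | hst
    · simp [Ioc_eq_empty_of_le hts]
    have ht : 0 < t := hs.trans hst
    refine setLIntegral_Ioc_lt_top_of_lintegral hw hqr hs ?_
    exact (ENNReal.rpow_lt_top_iff_of_pos (by positivity)).1
      (ENNReal.lt_top_of_mul_ne_top_left ((hE t ht).trans_lt hEfin).ne (hVpos t ht))
  constructor
  · rintro ⟨C, -, hC⟩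
    have hE₁ : ∀ t, 0 < t →
        (∫⁻ s in Ioc 0 t, w s * (∫⁻ τ in Ioc s t, u τ) ^ (q / r)) ^ (1 / q) *
          (∫⁻ τ in Ioi t, dualWeight p v τ) ^ ((p - 1) / p) ≤ C := fun t ht =>
      lintegral_primitive_rpow_le_of_inequality hp hq hr hw.1 hu.1 hv ht (hvfin' t ht) hC
    refine ⟨(iSup₂_le hE₁).trans_lt ENNReal.coe_lt_top, ?_⟩
    have hE₄ : ∀ t, 0 < t → (∫⁻ s in Ioc 0 t, w s) ^ (1 / q) *
        hardyIntegral p r u v t ^ ((p - r) / (p * r)) ≤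
        C * (ENNReal.ofReal ((p - 1) / (p - r)) *
          (ENNReal.ofReal (p / (p - r)) / ENNReal.ofReal ((p - 1) * r / (p - r))) ^ (1 / p)) :=
      fun t ht => mul_hardyIntegral_rpow_le hp hr hrp hu.1 hv ht
        (fun x hx => hvfin' x (ht.trans_le hx))
        (fun s => hufin C ENNReal.coe_lt_top hE₁ t s ht) fun h hh =>
          (mul_lintegral_rpow_le_of_inequality hq hr hw.1
            (antitone_setLIntegral_Ioi fun τ => (∫⁻ s in Ioi τ, h s) ^ r * u τ) t).trans (hC h hh)
    refine (iSup₂_le hE₄).trans_lt (ENNReal.mul_lt_top ENNReal.coe_lt_top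
      (ENNReal.mul_lt_top ENNReal.ofReal_lt_top
        (ENNReal.rpow_lt_top_of_nonneg (by positivity) (ENNReal.div_lt_top ENNReal.ofReal_ne_top
          ?_).ne)))
    exact (ENNReal.ofReal_pos.2 (by positivity)).ne'
  · rintro ⟨hE₁fin, hE₄fin⟩
    set E₁ := ⨆ t ∈ Ioi (0 : ℝ),
      (∫⁻ s in Ioc (0 : ℝ) t, w s * (∫⁻ τ in Ioc s t, u τ) ^ (q / r)) ^ (1 / q) *
        (∫⁻ τ in Ioi t, v τ ^ (1 - p / (p - 1))) ^ ((p - 1) / p) with hE₁def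
    set E₄ := ⨆ t ∈ Ioi (0 : ℝ), (∫⁻ s in Ioc (0 : ℝ) t, w s) ^ (1 / q) *
      (∫⁻ x in Ioi t, (∫⁻ τ in Ioc t x, u τ) ^ (r / (p - r)) * u x *
        (∫⁻ τ in Ioi x, v τ ^ (1 - p / (p - 1))) ^ ((p - 1) * r / (p - r))) ^
          ((p - r) / (p * r)) with hE₄def
    have hE₁ : ∀ t, 0 < t →
        (∫⁻ s in Ioc 0 t, w s * (∫⁻ τ in Ioc s t, u τ) ^ (q / r)) ^ (1 / q) *
          (∫⁻ τ in Ioi t, dualWeight p v τ) ^ ((p - 1) / p) ≤ E₁ := fun t ht =>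
      le_iSup₂_of_le t (mem_Ioi.2 ht) le_rfl
    have hE₄ : ∀ t, 0 < t → (∫⁻ s in Ioc 0 t, w s) ^ (1 / q) *
        hardyIntegral p r u v t ^ ((p - r) / (p * r)) ≤ E₄ := fun t ht =>
      le_iSup₂_of_le t (mem_Ioi.2 ht) le_rfl
    have hwfin : ∀ x, 0 < x → ∫⁻ s in Ioc 0 x, w s < ∞ := fun x hx =>
      (ENNReal.rpow_lt_top_iff_of_pos (by positivity)).1
        (ENNReal.lt_top_of_mul_ne_top_left ((hE₄ x hx).trans_lt hE₄fin).ne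
          ((ENNReal.rpow_eq_zero_iff_of_pos (by positivity)).not.2
            (hardyIntegral_ne_zero hp hr hrp hu hv hvfin' hx)))
    obtain ⟨D, hD, hDle⟩ := exists_lintegral_iterated_rpow_le hp hr hrp hpq hu.1 hw hv hvfin'
      (hufin E₁ hE₁fin hE₁) hwfin hE₁ hE₄ hE₁fin hE₄fin
    have hDq : D ^ (1 / q) < ∞ := ENNReal.rpow_lt_top_of_nonneg (by positivity) hD.ne
    refine ⟨(D ^ (1 / q)).toNNReal + 1, by positivity, fun h hh => ?_⟩
    rcases eq_or_ne (∫⁻ t in Ioi (0 : ℝ), h t ^ p * v t) ∞ with hN | hN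
    · rw [hN, ENNReal.top_rpow_of_pos (by positivity), ENNReal.mul_top (by simp)]
      exact le_top
    · refine (ENNReal.rpow_le_rpow (hDle h hh (lt_top_iff_ne_top.2 hN))
        (one_div_nonneg.2 hq.le)).trans ?_
      rw [ENNReal.mul_rpow_of_nonneg _ _ (by positivity), ← ENNReal.rpow_mul,
        show q / p * (1 / q) = 1 / p by field_simp]
      gcongr
      rw [ENNReal.coe_add, ENNReal.coe_toNNReal hDq.ne]
      exact le_self_add
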